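/- arXiv:1806.05866 — 7 statements merged into one kernel-verified Lean document; each statement's English description precedes it below -/
import Mathlib

section
/- Let G be a finite simple undirected connected graph with at least b vertices, where b ≥ 3 is an integer. Then b^(b-2) times the number of b-cliques of G equals the number of b-vertex tree subgraphs of G if and only if G is a complete graph. -/
/-- The number of `b`-cliques of `G`: `b`-element sets of pairwise adjacent vertices. -/
noncomputable def cliqueCount {V : Type*} (G : SimpleGraph V) (b : ℕ) : ℕ :=
  Nat.card {S : Finset V // S.card = b ∧ G.IsClique ↑S}

/-- The number of `b`-vertex tree subgraphs of `G`: pairs of a set `S` of `b` vertices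
together with `b - 1` edges of `G` between vertices of `S` forming a connected acyclic
graph spanning `S`. -/
noncomputable def treeSubCount {V : Type*} (G : SimpleGraph V) (b : ℕ) : ℕ :=
  Nat.card {p : Finset V × Finset (Sym2 V) //
    p.1.card = b ∧ p.2.card = b - 1 ∧
    (∀ e ∈ p.2, e ∈ G.edgeSet) ∧
    (∀ e ∈ p.2, ∀ v ∈ e, v ∈ p.1) ∧
    (∀ u ∈ p.1, ∀ v ∈ p.1, (SimpleGraph.fromEdgeSet (↑p.2 : Set (Sym2 V))).Reachable u v) ∧
    (SimpleGraph.fromEdgeSet (↑p.2 : Set (Sym2 V))).IsAcyclic}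

open Finset

/-- `IsTreeOn S E` says that the edge set `E` is a tree with vertex set `S`, built from a single
vertex by successively attaching leaves. -/
inductive IsTreeOn {V : Type*} [DecidableEq V] : Finset V → Finset (Sym2 V) → Prop
  | single (v : V) : IsTreeOn {v} ∅
  | leaf {S : Finset V} {E : Finset (Sym2 V)} {l w : V} :
      IsTreeOn S E → l ∉ S → w ∈ S → IsTreeOn (insert l S) (insert s(l, w) E)

/-- The only edge of `E` at `l` is `s(l, w)`. -/
def IsPendant {V : Type*} (E : Finset (Sym2 V)) (l w : V) : Prop :=
  s(l, w) ∈ E ∧ ∀ e ∈ E, l ∈ e → e = s(l, w)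

namespace IsTreeOn

variable {V : Type*} [DecidableEq V] {S : Finset V} {E : Finset (Sym2 V)}

lemma nonempty (h : IsTreeOn S E) : S.Nonempty := by
  cases h <;> simp

lemma mem_of_mem_edge (h : IsTreeOn S E) : ∀ e ∈ E, ∀ v ∈ e, v ∈ S := by
  induction h with
  | single v => simp
  | leaf h hl hw ih =>
    intro e he v hv
    rcases Finset.mem_insert.1 he with rfl | he
    · rcases Sym2.mem_iff.1 hv with rfl | rfl <;> simp [hw]
    · exact Finset.mem_insert_of_mem (ih e he v hv)

lemma not_isDiag (h : IsTreeOn S E) : ∀ e ∈ E, ¬ e.IsDiag := by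
  induction h with
  | single v => simp
  | leaf h hl hw ih =>
    intro e he
    rcases Finset.mem_insert.1 he with rfl | he
    · rw [Sym2.mk_isDiag_iff]
      rintro rfl
      exact hl hw
    · exact ih e he

lemma edge_notMem {l : V} (h : IsTreeOn S E) (hl : l ∉ S) (w : V) : s(l, w) ∉ E :=
  fun he ↦ hl (h.mem_of_mem_edge _ he l (by simp))

lemma card_edges (h : IsTreeOn S E) : E.card + 1 = S.card := by
  induction h with
  | single v => simp
  | leaf h hl hw ih => rw [card_insert_of_notMem hl, card_insert_of_notMem (h.edge_notMem hl _), ih]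

lemma eq_singleton_of_isolated {x : V} (h : IsTreeOn S E) (hx : x ∈ S) (hE : ∀ e ∈ E, x ∉ e) :
    S = {x} ∧ E = ∅ := by
  induction h with
  | single v => simp_all
  | @leaf S E l w h hl hw ih =>
    have h1 := hE _ (mem_insert_self _ _)
    rw [Sym2.mem_iff, not_or] at h1
    have := ih ((mem_insert.1 hx).resolve_left h1.1) fun e he ↦ hE e (mem_insert_of_mem he)
    rw [this.1, mem_singleton] at hw
    exact absurd hw.symm h1.2

lemma erase_leaf {l w : V} (h : IsTreeOn S E) (hl : IsPendant E l w) :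
    IsTreeOn (S.erase l) (E.erase s(l, w)) := by
  induction h with
  | single v => simp [IsPendant] at hl
  | @leaf S E m x h hm hx ih =>
    obtain ⟨h1, h2⟩ := hl
    by_cases hlm : l = m
    · subst hlm
      rw [← h2 _ (mem_insert_self _ _) (by simp), erase_insert hm, erase_insert (h.edge_notMem hm _)]
      exact h
    by_cases hlx : l = x
    · subst hlx
      have h3 := h2 _ (mem_insert_self _ _) (by simp)
      obtain ⟨rfl, rfl⟩ := h.eq_singleton_of_isolated hx fun e he hle ↦ by
        have := h2 e (mem_insert_of_mem he) hle
        rw [← h3] at this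
        exact h.edge_notMem hm _ (this ▸ he)
      rw [← h3]
      convert single m using 1
      · ext a; simp only [mem_erase, mem_insert, mem_singleton]; grind
      · simp
    have hne : s(m, x) ≠ s(l, w) := by
      intro he
      have : l ∈ s(m, x) := he ▸ (by simp)
      simp [hlm, hlx] at this
    rw [erase_insert_of_ne (Ne.symm hlm), erase_insert_of_ne hne]
    refine leaf (ih ⟨(mem_insert.1 h1).resolve_left hne.symm,
      fun e he ↦ h2 e (mem_insert_of_mem he)⟩) (by simp [hm]) (by simp [hx, Ne.symm hlx])

lemma exists_isPendant (h : IsTreeOn S E) (hS : 2 ≤ S.card) : ∃ l ∈ S, ∃ w, IsPendant E l w := by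
  cases h with
  | single v => simp at hS
  | @leaf S E l w h hl hw =>
    refine ⟨l, by simp, w, by simp, fun e he hle ↦ ?_⟩
    exact (mem_insert.1 he).resolve_right fun he ↦ hl (h.mem_of_mem_edge e he l hle)

lemma not_isPendant_of_isPendant {l w : V} (h : IsTreeOn S E) (hS : 3 ≤ S.card) (hl : IsPendant E l w)
    (x : V) : ¬ IsPendant E w x := by
  intro hw
  have hwS := h.mem_of_mem_edge _ hl.1 w (by simp)
  have hlS := h.mem_of_mem_edge _ hl.1 l (by simp)
  have hlw : l ≠ w := by simpa using h.not_isDiag _ hl.1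
  have hx := hw.2 _ hl.1 (by simp)
  have := (h.erase_leaf hl).eq_singleton_of_isolated (x := w) (by simp [hwS, hlw.symm])
    fun e he hwe ↦ (mem_erase.1 he).1 (by rw [hx]; exact hw.2 e (mem_of_mem_erase he) hwe)
  have h1 := card_erase_of_mem hlS
  rw [this.1, card_singleton] at h1
  omega

lemma reachable (h : IsTreeOn S E) : ∀ u ∈ S, ∀ v ∈ S,
    (SimpleGraph.fromEdgeSet (↑E : Set (Sym2 V))).Reachable u v := by
  induction h with
  | single v => simp
  | @leaf S E l w h hl hw ih =>
    have hle : SimpleGraph.fromEdgeSet (↑E : Set (Sym2 V)) ≤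
        SimpleGraph.fromEdgeSet (↑(insert s(l, w) E) : Set (Sym2 V)) :=
      SimpleGraph.fromEdgeSet_mono (by simp)
    have key : ∀ u ∈ insert l S,
        (SimpleGraph.fromEdgeSet (↑(insert s(l, w) E) : Set (Sym2 V))).Reachable u w := by
      intro u hu
      rcases mem_insert.1 hu with rfl | hu
      · apply SimpleGraph.Adj.reachable
        simp only [SimpleGraph.fromEdgeSet_adj]
        exact ⟨by simp, by rintro rfl; exact hl hw⟩
      · exact (ih u hu w hw).mono hle
    exact fun u hu v hv ↦ (key u hu).trans (key v hv).symm

lemma isAcyclic (h : IsTreeOn S E) :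
    (SimpleGraph.fromEdgeSet (↑E : Set (Sym2 V))).IsAcyclic := by
  induction h with
  | single v => simp
  | @leaf S E l w h hl hw ih =>
    rw [coe_insert, Set.insert_eq, Set.union_comm, SimpleGraph.fromEdgeSet_union]
    refine ih.sup_edge_of_not_reachable (u := l) (v := w) ?_
    rintro ⟨p⟩
    cases p with
    | nil => exact hl hw
    | cons hadj _ => exact h.edge_notMem hl _ (SimpleGraph.fromEdgeSet_adj _ |>.1 hadj).1

lemma exists_extension {H : SimpleGraph V} {U : Finset V} (h : IsTreeOn S E)
    (hE : ∀ e ∈ E, e ∈ H.edgeSet) (hSU : S ⊆ U) (hU : ∀ u v, H.Adj u v → v ∈ U)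
    (hreach : ∀ u ∈ U, ∀ v ∈ U, H.Reachable u v) {k : ℕ} (hk : S.card ≤ k) (hkU : k ≤ U.card) :
    ∃ S' E', S ⊆ S' ∧ S' ⊆ U ∧ S'.card = k ∧ (∀ e ∈ E', e ∈ H.edgeSet) ∧ IsTreeOn S' E' := by
  induction k, hk using Nat.le_induction with
  | base => exact ⟨S, E, subset_rfl, hSU, rfl, hE, h⟩
  | succ k hk ih =>
    obtain ⟨S', E', h1, h2, h3, h4, h5⟩ := ih (by omega)
    obtain ⟨v, hvU, hvS⟩ := exists_mem_notMem_of_card_lt_card (show S'.card < U.card by omega)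
    obtain ⟨u, hu⟩ := h5.nonempty
    obtain ⟨p⟩ := hreach u (h2 hu) v hvU
    obtain ⟨d, -, hd1, hd2⟩ := p.exists_boundary_dart (S' : Set V) (by simpa) (by simpa)
    refine ⟨insert d.snd S', insert s(d.snd, d.fst) E', h1.trans (subset_insert _ _),
      insert_subset (hU _ _ d.adj) h2, by rw [card_insert_of_notMem (by simpa using hd2), h3], ?_,
      h5.leaf (by simpa using hd2) (by simpa using hd1)⟩
    intro e he
    rcases mem_insert.1 he with rfl | he
    · exact d.adj.symm
    · exact h4 e he

lemma of_reachable (hS : S.Nonempty) (hcard : E.card = S.card - 1)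
    (hES : ∀ e ∈ E, ∀ v ∈ e, v ∈ S)
    (hreach : ∀ u ∈ S, ∀ v ∈ S, (SimpleGraph.fromEdgeSet (↑E : Set (Sym2 V))).Reachable u v) :
    IsTreeOn S E := by
  obtain ⟨v, hv⟩ := hS
  obtain ⟨S', E', -, h1, h2, h3, h4⟩ := (single v).exists_extension (U := S) (k := S.card)
    (by simp) (by simpa) (fun u v huv ↦ hES _ (SimpleGraph.fromEdgeSet_adj _ |>.1 huv).1 v (by simp))
    hreach (by simpa using card_pos.2 ⟨v, hv⟩) le_rfl
  obtain rfl := eq_of_subset_of_card_le h1 h2.ge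
  have hsub : E' ⊆ E := fun e he ↦ by
    have := h3 e he
    rw [SimpleGraph.edgeSet_fromEdgeSet] at this
    exact this.1
  obtain rfl := eq_of_subset_of_card_le hsub (by have := h4.card_edges; omega)
  exact h4

end IsTreeOn

section Counting

open Classical in
/-- The edge sets of the trees with vertex set `S`. -/
noncomputable def treesOn {V : Type*} [Fintype V] (S : Finset V) : Finset (Finset (Sym2 V)) :=
  univ.filter (IsTreeOn S)

open Classical in
/-- The edge sets of the trees with vertex set `S ∪ L` in which every vertex of `L` is a leaf
attached to a vertex of `S`. -/
noncomputable def treesWithLeaves {V : Type*} [Fintype V] (S L : Finset V) :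
    Finset (Finset (Sym2 V)) :=
  univ.filter fun E ↦ IsTreeOn (S ∪ L) E ∧ ∀ l ∈ L, ∃ w ∈ S, IsPendant E l w

variable {V : Type*} [Fintype V]

open Classical in
lemma card_treesWithLeaves_insert {S L : Finset V} {l : V} (h : Disjoint S L) (hlS : l ∉ S)
    (hlL : l ∉ L) :
    (treesWithLeaves S (insert l L)).card = (treesWithLeaves S L).card * S.card := by
  rw [← card_product]
  symm
  have hl : l ∉ S ∪ L := by simp [hlS, hlL]
  refine card_bij (fun p _ ↦ insert s(l, p.2) p.1) ?_ ?_ ?_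
  · rintro ⟨E, w⟩ hp
    simp only [treesWithLeaves, mem_product, mem_filter, mem_univ, true_and] at hp ⊢
    obtain ⟨⟨hE, hL⟩, hw⟩ := hp
    refine ⟨?_, ?_⟩
    · rw [union_insert]
      exact hE.leaf hl (mem_union_left _ hw)
    · intro m hm
      rcases mem_insert.1 hm with rfl | hm
      · refine ⟨w, hw, by simp, fun e he hme ↦ ?_⟩
        exact (mem_insert.1 he).resolve_right fun he ↦ hl (hE.mem_of_mem_edge e he _ hme)
      · obtain ⟨x, hx, h1, h2⟩ := hL m hm
        refine ⟨x, hx, mem_insert_of_mem h1, fun e he hme ↦ ?_⟩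
        rcases mem_insert.1 he with rfl | he
        · rcases Sym2.mem_iff.1 hme with hml | rfl
          · exact absurd (hml ▸ hm) hlL
          · exact absurd hm (disjoint_left.1 h hw)
        · exact h2 e he hme
  · rintro ⟨E, w⟩ hp ⟨E', w'⟩ hp' h
    simp only [treesWithLeaves, mem_product, mem_filter, mem_univ, true_and] at hp hp' h
    have h1 := hp.1.1.edge_notMem hl
    have h2 := hp'.1.1.edge_notMem hl
    have hw : s(l, w) = s(l, w') := by
      have : s(l, w) ∈ insert s(l, w') E' := h ▸ mem_insert_self _ _
      exact (mem_insert.1 this).resolve_right (h2 w)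
    rw [Sym2.congr_right] at hw
    subst hw
    rw [← erase_insert (h1 w), h, erase_insert (h2 w)]
  · intro E hE
    simp only [treesWithLeaves, mem_filter, mem_univ, true_and] at hE
    obtain ⟨hE, hL⟩ := hE
    obtain ⟨w, hw, hlw⟩ := hL l (mem_insert_self _ _)
    refine ⟨(E.erase s(l, w), w), ?_, insert_erase hlw.1⟩
    simp only [treesWithLeaves, mem_product, mem_filter, mem_univ, true_and]
    refine ⟨⟨?_, ?_⟩, hw⟩
    · have := hE.erase_leaf hlw
      rwa [union_insert, erase_insert hl] at this
    · intro m hm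
      obtain ⟨x, hx, h1, h2⟩ := hL m (mem_insert_of_mem hm)
      refine ⟨x, hx, mem_erase.2 ⟨fun he ↦ ?_, h1⟩, fun e he ↦ h2 e (mem_of_mem_erase he)⟩
      have : l ∈ s(m, x) := he ▸ (by simp)
      rcases Sym2.mem_iff.1 this with rfl | rfl
      · exact hlL hm
      · exact hlS hx

open Classical in
lemma card_treesWithLeaves {S L : Finset V} (h : Disjoint S L) :
    (treesWithLeaves S L).card = (treesOn S).card * S.card ^ L.card := by
  induction L using Finset.induction_on with
  | empty => simp [treesWithLeaves, treesOn]
  | insert l L hl ih =>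
    rw [disjoint_insert_right] at h
    rw [card_treesWithLeaves_insert h.2 h.1 hl, ih h.2, card_insert_of_notMem hl, pow_succ, mul_assoc]

lemma sum_powerset_neg_one_pow_mul_pow {α : Type*} (S : Finset α) {j : ℕ} (hj : j < S.card) :
    ∑ L ∈ S.powerset, (-1 : ℤ) ^ L.card * ((S.card - L.card : ℕ) : ℤ) ^ j = 0 := by
  rw [sum_powerset_apply_card (fun k ↦ (-1 : ℤ) ^ k * ((S.card - k : ℕ) : ℤ) ^ j),
    ← sum_range_reflect]
  have h := congrFun (fwdDiff_iter_pow_eq_zero_of_lt (R := ℤ) hj) 0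
  rw [fwdDiff_iter_eq_sum_shift] at h
  simp only [Pi.zero_apply] at h
  rw [← h]
  refine sum_congr rfl fun k hk ↦ ?_
  have hk' : k ≤ S.card := by simpa [Nat.lt_succ_iff] using hk
  have e1 : S.card + 1 - 1 - k = S.card - k := by omega
  rw [e1, Nat.choose_symm hk', Nat.sub_sub_self hk']
  simp
  ring

open Classical in
lemma alternating_sum_card_treesOn {S : Finset V} (hS : 3 ≤ S.card) :
    ∑ L ∈ S.powerset,
      (-1 : ℤ) ^ L.card * (((treesOn (S \ L)).card * (S \ L).card ^ L.card : ℕ) : ℤ) = 0 := by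
  have h : ∀ L ∈ S.powerset, (treesOn (S \ L)).card * (S \ L).card ^ L.card =
      ((treesOn S).filter fun E ↦ ∀ l ∈ L, ∃ w, IsPendant E l w).card := by
    intro L hL
    rw [mem_powerset] at hL
    rw [← card_treesWithLeaves sdiff_disjoint]
    congr 1
    ext E
    simp only [treesWithLeaves, treesOn, mem_filter, mem_univ, true_and, sdiff_union_of_subset hL]
    refine and_congr_right fun hE ↦ ⟨fun H l hl ↦ (H l hl).imp fun w hw ↦ hw.2, fun H l hl ↦ ?_⟩
    obtain ⟨w, hw⟩ := H l hl
    refine ⟨w, mem_sdiff.2 ⟨hE.mem_of_mem_edge _ hw.1 w (by simp), fun hwL ↦ ?_⟩, hw⟩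
    obtain ⟨x, hx⟩ := H w hwL
    exact hE.not_isPendant_of_isPendant hS hw x hx
  calc
    _ = ∑ L ∈ S.powerset, ∑ E ∈ treesOn S,
          if ∀ l ∈ L, ∃ w, IsPendant E l w then (-1 : ℤ) ^ L.card else 0 := by
      refine sum_congr rfl fun L hL ↦ ?_
      rw [h L hL, ← sum_filter, sum_const, nsmul_eq_mul, mul_comm]
    _ = ∑ E ∈ treesOn S, ∑ L ∈ (S.filter fun l ↦ ∃ w, IsPendant E l w).powerset,
          (-1 : ℤ) ^ L.card := by
      rw [sum_comm]
      refine sum_congr rfl fun E _ ↦ ?_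
      rw [← sum_filter]
      congr 1
      ext L
      simp only [mem_filter, mem_powerset, subset_iff]
      grind
    _ = 0 := by
      refine sum_eq_zero fun E hE ↦ sum_powerset_neg_one_pow_card_of_nonempty ?_
      obtain ⟨l, hl, hw⟩ := (mem_filter.1 hE).2.exists_isPendant (by omega)
      exact ⟨l, mem_filter.2 ⟨hl, hw⟩⟩

open Classical in
lemma card_treesOn_of_card_le_two {S : Finset V} (hS : S.Nonempty) (hS2 : S.card ≤ 2) :
    (treesOn S).card = 1 := by
  rw [card_eq_one]
  have hpos := hS.card_pos
  obtain h1 | h2 : S.card = 1 ∨ S.card = 2 := by omega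
  · obtain ⟨v, rfl⟩ := card_eq_one.1 h1
    refine ⟨∅, eq_singleton_iff_unique_mem.2 ⟨by simp [treesOn, IsTreeOn.single], fun E hE ↦ ?_⟩⟩
    have hE : IsTreeOn {v} E := (mem_filter.1 hE).2
    have := hE.card_edges
    rw [h1] at this
    exact card_eq_zero.1 (by omega)
  · obtain ⟨u, v, huv, rfl⟩ := card_eq_two.1 h2
    refine ⟨{s(u, v)}, eq_singleton_iff_unique_mem.2 ⟨?_, fun E hE ↦ ?_⟩⟩
    · exact mem_filter.2 ⟨mem_univ _, .leaf (.single v) (by simpa) (by simp)⟩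
    · have hE : IsTreeOn {u, v} E := (mem_filter.1 hE).2
      have hcard := hE.card_edges
      rw [h2] at hcard
      obtain ⟨e, rfl⟩ := card_eq_one.1 (show E.card = 1 by omega)
      have h3 := hE.mem_of_mem_edge e (by simp)
      have h4 := hE.not_isDiag e (by simp)
      induction e with
      | _ x y =>
        have hx := h3 x (by simp)
        have hy := h3 y (by simp)
        simp only [mem_insert, mem_singleton] at hx hy
        rw [Sym2.mk_isDiag_iff] at h4
        rw [singleton_inj, Sym2.eq_iff]
        grind

open Classical in
/-- **Cayley's formula** for the number of trees on a nonempty finite vertex set. -/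
theorem card_treesOn {S : Finset V} (hS : S.Nonempty) :
    (treesOn S).card = S.card ^ (S.card - 2) := by
  induction hn : S.card using Nat.strong_induction_on generalizing S with
  | _ n ih =>
  have hpos := hS.card_pos
  rcases lt_or_ge n 3 with hn3 | hn3
  · rw [show n - 2 = 0 by omega, pow_zero]
    exact card_treesOn_of_card_le_two hS (by omega)
  have h1 := alternating_sum_card_treesOn (hn ▸ hn3)
  have h2 := sum_powerset_neg_one_pow_mul_pow S (show S.card - 2 < S.card by omega)
  rw [← add_sum_erase _ _ (empty_mem_powerset S)] at h1 h2
  have h3 : ∀ L ∈ S.powerset.erase ∅,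
      (-1 : ℤ) ^ L.card * (((treesOn (S \ L)).card * (S \ L).card ^ L.card : ℕ) : ℤ) =
        (-1 : ℤ) ^ L.card * ((S.card - L.card : ℕ) : ℤ) ^ (S.card - 2) := by
    intro L hL
    rw [mem_erase, mem_powerset] at hL
    have hLpos := (nonempty_iff_ne_empty.2 hL.1).card_pos
    have hLS := card_le_card hL.2
    rw [← card_sdiff_of_subset hL.2]
    have hc := card_sdiff_of_subset hL.2
    congr 1
    norm_cast
    rcases (S \ L).eq_empty_or_nonempty with he | hne
    · simp only [he, card_empty]
      rw [zero_pow (by omega), zero_pow (by omega), mul_zero]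
    · have := hne.card_pos
      rw [ih _ (by omega) hne rfl, ← pow_add]
      rcases Nat.lt_or_ge (S \ L).card 2 with h | h
      · rw [show (S \ L).card = 1 by omega, one_pow, one_pow]
      · congr 1
        omega
  rw [sum_congr rfl h3] at h1
  have h4 := add_right_cancel (h1.trans h2.symm)
  simp only [card_empty, pow_zero, one_mul, sdiff_empty, mul_one, Nat.sub_zero, hn] at h4
  exact_mod_cast h4

end Counting

section CliqueVersusTree

variable {V : Type*} [Fintype V]

open Classical in
/-- The `b`-vertex trees in `G`, as pairs of a vertex set and an edge set. -/
noncomputable def treePairs (G : SimpleGraph V) (b : ℕ) :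
    Finset (Finset V × Finset (Sym2 V)) :=
  univ.filter fun p ↦ p.1.card = b ∧ (∀ e ∈ p.2, e ∈ G.edgeSet) ∧ IsTreeOn p.1 p.2

open Classical in
lemma treeSubCount_eq_card_treePairs (G : SimpleGraph V) {b : ℕ} (hb : 1 ≤ b) :
    treeSubCount G b = (treePairs G b).card := by
  rw [treeSubCount, treePairs, Nat.card_eq_fintype_card, Fintype.card_subtype]
  congr 1
  ext ⟨S, E⟩
  simp only [mem_filter, mem_univ, true_and]
  constructor
  · rintro ⟨h1, h2, h3, h4, h5, -⟩
    exact ⟨h1, h3, .of_reachable (card_pos.1 (by omega)) (by omega) h4 h5⟩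
  · rintro ⟨h1, h2, h3⟩
    exact ⟨h1, by have := h3.card_edges; omega, h2, h3.mem_of_mem_edge, h3.reachable, h3.isAcyclic⟩

open Classical in
lemma card_treePairs_filter_isClique (G : SimpleGraph V) {b : ℕ} (hb : 1 ≤ b) :
    ((treePairs G b).filter fun p ↦ G.IsClique ↑p.1).card = b ^ (b - 2) * cliqueCount G b := by
  rw [cliqueCount, Nat.card_eq_fintype_card, Fintype.card_subtype,
    card_eq_sum_card_fiberwise (f := Prod.fst)
      (t := univ.filter fun S : Finset V ↦ S.card = b ∧ G.IsClique ↑S), mul_comm, ← smul_eq_mul,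
    ← sum_const]
  · refine sum_congr rfl fun S hS ↦ ?_
    obtain ⟨rfl, hclique⟩ := (mem_filter.1 hS).2
    rw [← card_treesOn (card_pos.1 hb)]
    refine card_bij (fun p _ ↦ p.2) ?_ ?_ ?_
    · rintro ⟨S', E⟩ hp
      simp only [treePairs, mem_filter] at hp
      simpa [treesOn, ← hp.2] using hp.1.1.2.2.2
    · rintro ⟨S₁, E₁⟩ h₁ ⟨S₂, E₂⟩ h₂ h
      exact Prod.ext ((mem_filter.1 h₁).2.trans (mem_filter.1 h₂).2.symm) h
    · intro E hE
      have hE : IsTreeOn S E := (mem_filter.1 hE).2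
      refine ⟨(S, E), ?_, rfl⟩
      simp only [treePairs, mem_filter, mem_univ, true_and, and_true]
      refine ⟨⟨fun e he ↦ ?_, hE⟩, hclique⟩
      have h1 := hE.mem_of_mem_edge e he
      have h2 := hE.not_isDiag e he
      induction e with
      | _ u v => exact hclique (h1 u (by simp)) (h1 v (by simp)) (by simpa using h2)
  · intro p hp
    simp only [treePairs, coe_filter, mem_filter, mem_univ, true_and, Set.mem_ofPred_eq] at hp ⊢
    exact ⟨hp.1.1, hp.2⟩

open Classical in
lemma exists_mem_treePairs_not_isClique {G : SimpleGraph V} {b : ℕ} (hb : 3 ≤ b)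
    (hV : b ≤ Fintype.card V) (hconn : G.Connected) (hG : G ≠ ⊤) :
    ∃ p ∈ treePairs G b, ¬ G.IsClique ↑p.1 := by
  obtain ⟨x, y, hxy, hadj⟩ : ∃ x y, x ≠ y ∧ ¬ G.Adj x y := by
    by_contra! h
    exact hG (SimpleGraph.ext (by ext x y; exact ⟨fun h ↦ h.ne, h x y⟩))
  have hr := hconn.preconnected x y
  obtain ⟨p, hp⟩ := hr.exists_walk_length_eq_dist
  obtain ⟨u, v, w, huv, hvw, huw, hne⟩ := SimpleGraph.Walk.exists_adj_adj_not_adj_ne hp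
    (hr.one_lt_dist_of_ne_of_not_adj hxy hadj)
  have hT : IsTreeOn {w, v, u} {s(w, v), s(v, u)} := by
    refine .leaf (.leaf (.single u) ?_ ?_) ?_ ?_ <;> simp [huv.ne', hvw.ne', hne.symm]
  obtain ⟨S, E, h1, -, h3, h4, h5⟩ := hT.exists_extension (H := G) (U := univ) (k := b)
    (by simp [huv.symm, hvw.symm]) (subset_univ _) (by simp)
    (fun u _ v _ ↦ hconn.preconnected u v) (card_le_three.trans hb) (by simpa using hV)
  refine ⟨(S, E), by simpa [treePairs, h3, h5] using h4, fun hc ↦ huw ?_⟩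
  exact hc (h1 (by simp)) (h1 (by simp)) hne

end CliqueVersusTree

theorem stmt0 {V : Type*} [Fintype V] (G : SimpleGraph V) (b : ℕ)
    (hb : 3 ≤ b) (hV : b ≤ Fintype.card V) (hconn : G.Connected) :
    b ^ (b - 2) * cliqueCount G b = treeSubCount G b ↔ G = ⊤ := by
  classical
  rw [treeSubCount_eq_card_treePairs G (by omega), ← card_treePairs_filter_isClique G (by omega),
    card_filter_eq_iff]
  constructor
  · intro h
    by_contra hG
    obtain ⟨p, hp, hc⟩ := exists_mem_treePairs_not_isClique hb hV hconn hG
    exact hc (h p hp)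
  · rintro rfl p -
    exact fun u _ v _ huv ↦ huv
end

section
/- Let G be a finite simple undirected graph with adjacency matrix A and degree k_v at vertex v. Then twice the number of tadpoles of G equals ∑_v (A³)_{vv} (k_v − 2), where the sum is over all vertices v with k_v > 2 (equivalently over all vertices, since (A³)_{vv}(k_v − 2) contributes the same total when restricted to k_v > 2 after accounting for signs is avoided by summing (A³)_{vv} max(k_v − 2, 0); the identity is 2 · (number of tadpoles) = ∑_{v : k_v > 2} (A³)_{vv}(k_v − 2)). -/
/-- The number of tadpoles of `G`: subgraphs on 4 distinct vertices consisting of a triangle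
`{a, b, c}` together with one additional edge of `G` joining a vertex of the triangle to the
fourth vertex `d`. -/
noncomputable def tadpoleCount {V : Type*} [DecidableEq V] (G : SimpleGraph V) : ℕ :=
  Nat.card {T : Finset (Sym2 V) // ∃ a b c d : V, ([a, b, c, d] : List V).Nodup ∧
    G.Adj a b ∧ G.Adj b c ∧ G.Adj a c ∧ G.Adj a d ∧
    T = {s(a, b), s(b, c), s(a, c), s(a, d)}}

/-- The ordered pairs `(b, c)` completing `v` to a triangle of `G`. -/
def SimpleGraph.trianglePairs {V : Type*} [Fintype V] (G : SimpleGraph V)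
    [DecidableRel G.Adj] (v : V) : Finset (V × V) :=
  Finset.univ.filter fun p => G.Adj v p.1 ∧ G.Adj p.1 p.2 ∧ G.Adj v p.2

theorem SimpleGraph.adjMatrix_pow_three_apply_self {V : Type*} [Fintype V] [DecidableEq V]
    (G : SimpleGraph V) [DecidableRel G.Adj] (v : V) :
    (G.adjMatrix ℕ ^ 3) v v = (G.trianglePairs v).card := by
  rw [pow_three, Matrix.mul_apply, trianglePairs, Finset.card_filter, Fintype.sum_prod_type]
  refine Finset.sum_congr rfl fun b _ => ?_
  rw [Matrix.mul_apply, Finset.mul_sum]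
  refine Finset.sum_congr rfl fun c _ => ?_
  simp only [adjMatrix_apply, G.adj_comm c v]
  split_ifs <;> simp_all

/-- The tadpoles of `G` with a choice of labels: `⟨a, (b, c), d⟩` stands for the triangle
`{a, b, c}` with the additional edge `ad`. -/
def SimpleGraph.labelledTadpoles {V : Type*} [Fintype V] [DecidableEq V] (G : SimpleGraph V)
    [DecidableRel G.Adj] : Finset (Σ _ : V, Σ _ : V × V, V) :=
  Finset.univ.sigma fun v => (G.trianglePairs v).sigma fun p =>
    G.neighborFinset v \ {p.1, p.2}

theorem SimpleGraph.card_labelledTadpoles {V : Type*} [Fintype V] [DecidableEq V]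
    (G : SimpleGraph V) [DecidableRel G.Adj] :
    G.labelledTadpoles.card = ∑ v, (G.adjMatrix ℕ ^ 3) v v * (G.degree v - 2) := by
  rw [labelledTadpoles, Finset.card_sigma]
  refine Finset.sum_congr rfl fun v _ => ?_
  rw [Finset.card_sigma, adjMatrix_pow_three_apply_self, ← smul_eq_mul]
  refine Finset.sum_const_nat fun p hp => ?_
  simp only [trianglePairs, Finset.mem_filter, Finset.mem_univ, true_and] at hp
  rw [Finset.card_sdiff_of_subset, Finset.card_pair hp.2.1.ne, card_neighborFinset_eq_degree]
  intro x hx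
  simp only [Finset.mem_insert, Finset.mem_singleton] at hx
  rcases hx with rfl | rfl <;> simp [hp]

/-- The edges of the tadpole labelled by `⟨a, (b, c), d⟩`. -/
def tadpoleEdges {V : Type*} [DecidableEq V] (x : Σ _ : V, Σ _ : V × V, V) :
    Finset (Sym2 V) :=
  {s(x.1, x.2.1.1), s(x.2.1.1, x.2.1.2), s(x.1, x.2.1.2), s(x.1, x.2.2)}

theorem SimpleGraph.mem_labelledTadpoles {V : Type*} [Fintype V] [DecidableEq V]
    (G : SimpleGraph V) [DecidableRel G.Adj] {a b c d : V} :
    ⟨a, (b, c), d⟩ ∈ G.labelledTadpoles ↔ ([a, b, c, d] : List V).Nodup ∧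
      G.Adj a b ∧ G.Adj b c ∧ G.Adj a c ∧ G.Adj a d := by
  have := @SimpleGraph.Adj.ne _ G
  simp only [labelledTadpoles, trianglePairs, Finset.mem_sigma, Finset.mem_filter,
    Finset.mem_univ, true_and, Finset.mem_sdiff, mem_neighborFinset, Finset.mem_insert,
    Finset.mem_singleton, List.nodup_cons, List.mem_cons, List.not_mem_nil, or_false,
    not_false_eq_true, List.nodup_nil, and_true]
  grind

theorem tadpoleEdges_eq_iff {V : Type*} [DecidableEq V] {a b c d a' b' c' d' : V}
    (h : ([a, b, c, d] : List V).Nodup) (h' : ([a', b', c', d'] : List V).Nodup) :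
    tadpoleEdges ⟨a', (b', c'), d'⟩ = tadpoleEdges ⟨a, (b, c), d⟩ ↔
      a' = a ∧ d' = d ∧ (b' = b ∧ c' = c ∨ b' = c ∧ c' = b) := by
  simp only [List.nodup_cons, List.mem_cons, List.not_mem_nil, or_false,
    not_false_eq_true, List.nodup_nil, and_true, not_or] at h h'
  constructor
  · intro e
    have key (x y : V) (hm : s(x, y) ∈ tadpoleEdges ⟨a', (b', c'), d'⟩) :
        s(x, y) ∈ tadpoleEdges ⟨a, (b, c), d⟩ := e ▸ hm
    have h₁ := key a' b' (by simp [tadpoleEdges])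
    have h₂ := key a' c' (by simp [tadpoleEdges])
    have h₃ := key a' d' (by simp [tadpoleEdges])
    have h₄ := key b' c' (by simp [tadpoleEdges])
    simp only [tadpoleEdges, Finset.mem_insert, Finset.mem_singleton, Sym2.eq_iff]
      at h₁ h₂ h₃ h₄
    have ha : a' = a := by grind
    subst ha
    grind
  · rintro ⟨rfl, rfl, ⟨rfl, rfl⟩ | ⟨rfl, rfl⟩⟩
    · rfl
    · ext z
      simp only [tadpoleEdges, Finset.mem_insert, Finset.mem_singleton, Sym2.eq_swap (a := b')]
      tauto

theorem tadpoleCount_eq_card_image {V : Type*} [Fintype V] [DecidableEq V]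
    (G : SimpleGraph V) [DecidableRel G.Adj] :
    tadpoleCount G = (G.labelledTadpoles.image tadpoleEdges).card := by
  refine Nat.subtype_card _ fun T => ?_
  simp only [Finset.mem_image, Sigma.exists, Prod.exists, G.mem_labelledTadpoles, tadpoleEdges,
    and_assoc, eq_comm (a := T)]

theorem card_labelledTadpoles_eq_two_mul {V : Type*} [Fintype V] [DecidableEq V]
    (G : SimpleGraph V) [DecidableRel G.Adj] :
    G.labelledTadpoles.card = 2 * (G.labelledTadpoles.image tadpoleEdges).card := by
  rw [Finset.card_eq_sum_card_image tadpoleEdges, mul_comm]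
  refine Finset.sum_const_nat fun T hT => ?_
  obtain ⟨⟨a, ⟨b, c⟩, d⟩, hx, rfl⟩ := Finset.mem_image.1 hT
  have hx' := G.mem_labelledTadpoles.1 hx
  have hbc : b ≠ c := hx'.2.2.1.ne
  rw [Finset.card_eq_two]
  refine ⟨⟨a, (b, c), d⟩, ⟨a, (c, b), d⟩, by simp [hbc], ?_⟩
  ext ⟨a', ⟨b', c'⟩, d'⟩
  have hswap : ⟨a, (c, b), d⟩ ∈ G.labelledTadpoles := by
    rw [G.mem_labelledTadpoles]
    obtain ⟨hn, h₁, h₂, h₃, h₄⟩ := hx'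
    exact ⟨((List.Perm.swap b c [d]).cons a).nodup_iff.2 hn, h₃, h₂.symm, h₁, h₄⟩
  simp only [Finset.mem_filter, Finset.mem_insert, Finset.mem_singleton, Sigma.mk.injEq,
    heq_eq_eq, Prod.mk.injEq]
  constructor
  · rintro ⟨hm, he⟩
    have := (tadpoleEdges_eq_iff hx'.1 (G.mem_labelledTadpoles.1 hm).1).1 he
    tauto
  · intro h
    have hm : ⟨a', (b', c'), d'⟩ ∈ G.labelledTadpoles := by
      rcases h with ⟨rfl, ⟨rfl, rfl⟩, rfl⟩ | ⟨rfl, ⟨rfl, rfl⟩, rfl⟩ <;> assumption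
    refine ⟨hm, (tadpoleEdges_eq_iff hx'.1 (G.mem_labelledTadpoles.1 hm).1).2 ?_⟩
    tauto

theorem stmt7 {V : Type*} [Fintype V] [DecidableEq V] (G : SimpleGraph V)
    [DecidableRel G.Adj] :
    2 * tadpoleCount G =
      ∑ v ∈ Finset.univ.filter (fun v => 2 < G.degree v),
        (G.adjMatrix ℕ ^ 3) v v * (G.degree v - 2) := by
  rw [tadpoleCount_eq_card_image, ← card_labelledTadpoles_eq_two_mul, G.card_labelledTadpoles]
  refine (Finset.sum_filter_of_ne fun v _ hv => ?_).symm
  by_contra hd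
  exact hv (by rw [Nat.sub_eq_zero_of_le (not_lt.1 hd), mul_zero])
end

section
/- Let G be a finite simple undirected graph. For each vertex v, let A_{N(v)} be the adjacency matrix of the subgraph of G induced by the neighborhood N(v) of v. Then 24 times the number of 4-cliques of G equals ∑_v tr(A_{N(v)}³). -/
/-- The number of 4-cliques of `G`: 4-element sets of pairwise adjacent vertices. -/
noncomputable def fourCliqueCount {V : Type*} (G : SimpleGraph V) : ℕ :=
  Nat.card {S : Finset V // S.card = 4 ∧ G.IsClique ↑S}

open scoped Nat in
/-- Injectively labelled `n`-cliques are counted by `n!` times the number of `n`-cliques. -/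
theorem card_pairwise_adj_eq_factorial_mul {V : Type*} [Finite V] (G : SimpleGraph V) (n : ℕ) :
    Nat.card {f : Fin n → V // Pairwise fun i j => G.Adj (f i) (f j)} =
      n ! * Nat.card {S : Finset V // S.card = n ∧ G.IsClique ↑S} := by
  classical
  have := Fintype.ofFinite V
  let F : (Σ S : {S : Finset V // S.card = n ∧ G.IsClique ↑S}, Fin n ≃ S.1) →
      {f : Fin n → V // Pairwise fun i j => G.Adj (f i) (f j)} := fun x =>
    ⟨fun i => x.2 i, fun i j hij => x.1.2.2 (x.2 i).2 (x.2 j).2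
      fun h => hij (x.2.injective (Subtype.ext h))⟩
  have hF : Function.Bijective F := by
    constructor
    · rintro ⟨⟨S, hS⟩, e⟩ ⟨⟨T, hT⟩, e'⟩ h
      have h' : ∀ i, (e i : V) = e' i := fun i => congrFun (congrArg Subtype.val h) i
      obtain rfl : S = T := by
        ext x
        constructor
        · intro hx
          obtain ⟨i, hi⟩ := e.surjective ⟨x, hx⟩
          have := (e' i).2
          rwa [← h' i, hi] at this
        · intro hx
          obtain ⟨i, hi⟩ := e'.surjective ⟨x, hx⟩
          have := (e i).2
          rwa [h' i, hi] at this
      obtain rfl : e = e' := Equiv.ext fun i => Subtype.ext (h' i)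
      rfl
    · rintro ⟨f, hf⟩
      have hinj : Function.Injective f := fun i j h => by
        by_contra hij
        exact (hf hij).ne h
      refine ⟨⟨⟨Finset.univ.image f, ?_, ?_⟩, Equiv.ofBijective
        (fun i => ⟨f i, Finset.mem_image_of_mem f (Finset.mem_univ i)⟩) ⟨?_, ?_⟩⟩, rfl⟩
      · rw [Finset.card_image_of_injective _ hinj, Finset.card_fin]
      · intro x hx y hy hxy
        simp only [Finset.coe_image, Finset.coe_univ, Set.image_univ, Set.mem_range] at hx hy
        obtain ⟨i, rfl⟩ := hx
        obtain ⟨j, rfl⟩ := hy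
        exact hf fun h => hxy (congrArg f h)
      · exact fun i j h => hinj (congrArg Subtype.val h)
      · rintro ⟨x, hx⟩
        obtain ⟨i, -, rfl⟩ := Finset.mem_image.1 hx
        exact ⟨i, rfl⟩
  have hcard (S : {S : Finset V // S.card = n ∧ G.IsClique ↑S}) :
      Fintype.card (Fin n ≃ S.1) = n ! := by
    rw [Fintype.card_equiv (Fintype.equivOfCardEq (by simp [S.2.1])), Fintype.card_fin]
  rw [← Nat.card_congr (Equiv.ofBijective F hF), Nat.card_eq_fintype_card, Fintype.card_sigma,
    Finset.sum_congr rfl fun S _ => hcard S, Finset.sum_const, smul_eq_mul, mul_comm,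
    Finset.card_univ, Nat.card_eq_fintype_card]

/-- The trace of the cube of the adjacency matrix of a neighborhood, as a sum over all triples. -/
theorem trace_adjMatrix_induce_neighborSet_pow_three {V : Type*} [Fintype V] [DecidableEq V]
    (G : SimpleGraph V) [DecidableRel G.Adj] (v : V) :
    Matrix.trace ((G.induce (G.neighborSet v)).adjMatrix ℕ ^ 3) =
      ∑ a, ∑ b, ∑ c, if (G.Adj v a ∧ G.Adj v b ∧ G.Adj v c) ∧
        G.Adj a b ∧ G.Adj b c ∧ G.Adj c a then 1 else 0 := by
  have key (f : V → ℕ) : ∑ a : G.neighborSet v, f a = ∑ a, if G.Adj v a then f a else 0 := by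
    rw [← Finset.sum_filter]
    exact (Finset.sum_subtype _ (by simp) f).symm
  have htr : Matrix.trace ((G.induce (G.neighborSet v)).adjMatrix ℕ ^ 3) =
      ∑ a : G.neighborSet v, ∑ b : G.neighborSet v, ∑ c : G.neighborSet v,
        if G.Adj a b ∧ G.Adj b c ∧ G.Adj c a then 1 else 0 := by
    simp only [Matrix.trace, Matrix.diag, pow_succ, pow_zero, one_mul, Matrix.mul_apply,
      SimpleGraph.adjMatrix_apply, SimpleGraph.comap_adj, Function.Embedding.subtype_apply,
      Finset.sum_mul]
    refine Finset.sum_congr rfl fun a _ => ?_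
    rw [Finset.sum_comm]
    refine Finset.sum_congr rfl fun b _ => Finset.sum_congr rfl fun c _ => ?_
    split_ifs <;> simp_all
  rw [htr, key fun a => ∑ b : G.neighborSet v, ∑ c : G.neighborSet v,
    if G.Adj a b ∧ G.Adj b c ∧ G.Adj c a then 1 else 0]
  refine Finset.sum_congr rfl fun a _ => ?_
  rw [key fun b => ∑ c : G.neighborSet v, if G.Adj a b ∧ G.Adj b c ∧ G.Adj c a then 1 else 0]
  by_cases ha : G.Adj v a
  · rw [if_pos ha]
    refine Finset.sum_congr rfl fun b _ => ?_
    rw [key fun c => if G.Adj a b ∧ G.Adj b c ∧ G.Adj c a then 1 else 0]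
    by_cases hb : G.Adj v b
    · simp [ha, hb, ite_and]
    · simp [hb]
  · simp [ha]

theorem stmt8 {V : Type*} [Fintype V] [DecidableEq V] (G : SimpleGraph V)
    [DecidableRel G.Adj] :
    24 * fourCliqueCount G =
      ∑ v, Matrix.trace ((G.induce (G.neighborSet v)).adjMatrix ℕ ^ 3) := by
  let e : {p : V × V × V × V // (G.Adj p.1 p.2.1 ∧ G.Adj p.1 p.2.2.1 ∧ G.Adj p.1 p.2.2.2) ∧
        G.Adj p.2.1 p.2.2.1 ∧ G.Adj p.2.2.1 p.2.2.2 ∧ G.Adj p.2.2.2 p.2.1} ≃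
      {f : Fin 4 → V // Pairwise fun i j => G.Adj (f i) (f j)} :=
    { toFun := fun p => ⟨![p.1.1, p.1.2.1, p.1.2.2.1, p.1.2.2.2], by
        obtain ⟨⟨v, a, b, c⟩, ⟨hva, hvb, hvc⟩, hab, hbc, hca⟩ := p
        have hac := hca.symm
        intro i j hij
        fin_cases i <;> fin_cases j <;> simp_all [SimpleGraph.adj_comm]⟩
      invFun := fun f => ⟨(f.1 0, f.1 1, f.1 2, f.1 3),
        ⟨f.2 (by decide), f.2 (by decide), f.2 (by decide)⟩,
        f.2 (by decide), f.2 (by decide), f.2 (by decide)⟩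
      left_inv := fun _ => rfl
      right_inv := fun f => by
        ext i
        fin_cases i <;> rfl }
  have h := card_pairwise_adj_eq_factorial_mul G 4
  rw [← Nat.card_congr e, Nat.card_eq_fintype_card, Fintype.card_subtype, Finset.card_filter] at h
  simp only [Fintype.sum_prod_type] at h
  simp only [trace_adjMatrix_induce_neighborSet_pow_three]
  exact h.symm
end

section
/- Let G be a finite simple undirected graph with adjacency matrix A. Then ∑_{u ≠ v} (A⁴)_{uv} = 2·(number of 5-paths) + 4·(number of 3-paths) + 18·(number of triangles) + 6·(number of 4-stars) + 4·(number of 4-paths) + 4·(number of tadpoles), where the sum is over all ordered pairs of distinct vertices. -/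
/-- The number of triangles of `G`: 3-element sets of pairwise adjacent vertices. -/
noncomputable def triangleCount {V : Type*} (G : SimpleGraph V) : ℕ :=
  Nat.card {S : Finset V // S.card = 3 ∧ G.IsClique ↑S}

/-- The number of 3-paths of `G`: pairs `(v, {a, b})` where `a` and `b` are two distinct
neighbours of the vertex `v`. -/
noncomputable def threePathCount {V : Type*} (G : SimpleGraph V) : ℕ :=
  Nat.card {p : V × Finset V // p.2.card = 2 ∧ ∀ v ∈ p.2, G.Adj p.1 v}

/-- The number of 4-stars of `G`: pairs `(v, S)` where `S` is a 3-element subset of the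
neighbourhood of the vertex `v`. -/
noncomputable def fourStarCount {V : Type*} (G : SimpleGraph V) : ℕ :=
  Nat.card {p : V × Finset V // p.2.card = 3 ∧ ∀ v ∈ p.2, G.Adj p.1 v}

/-- The number of 4-paths of `G`: unordered sets of three edges `{ab, bc, cd}` of `G`
on four distinct vertices `a`, `b`, `c`, `d`. -/
noncomputable def fourPathCount {V : Type*} [DecidableEq V] (G : SimpleGraph V) : ℕ :=
  Nat.card {T : Finset (Sym2 V) // ∃ a b c d : V, ([a, b, c, d] : List V).Nodup ∧
    G.Adj a b ∧ G.Adj b c ∧ G.Adj c d ∧ T = {s(a, b), s(b, c), s(c, d)}}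

/-- The number of 5-paths of `G`: unordered sets of four edges `{ab, bc, cd, de}` of `G`
on five distinct vertices `a`, `b`, `c`, `d`, `e`. -/
noncomputable def fivePathCount {V : Type*} [DecidableEq V] (G : SimpleGraph V) : ℕ :=
  Nat.card {T : Finset (Sym2 V) // ∃ a b c d e : V, ([a, b, c, d, e] : List V).Nodup ∧
    G.Adj a b ∧ G.Adj b c ∧ G.Adj c d ∧ G.Adj d e ∧
    T = {s(a, b), s(b, c), s(c, d), s(d, e)}}

open Finset in
/-- Double counting along a map all of whose nonempty fibres have the same cardinality `k`. -/
theorem card_filter_eq_mul_natCard {α β : Type*} [Fintype α] [DecidableEq β] (P : α → Prop)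
    [DecidablePred P] (Q : β → Prop) (f : α → β) (k : ℕ)
    (hQ : ∀ b, Q b ↔ ∃ a, P a ∧ b = f a)
    (hk : ∀ a, P a → #{b | P b ∧ f b = f a} = k) :
    #{a | P a} = k * Nat.card {b // Q b} := by
  have himage : Nat.card {b // Q b} = #(({a | P a} : Finset α).image f) :=
    Nat.subtype_card _ fun b => by simp [hQ, eq_comm]
  rw [himage, mul_comm, ← smul_eq_mul, ← sum_const, card_eq_sum_card_image f]
  refine sum_congr rfl fun b hb => ?_
  obtain ⟨a, ha, rfl⟩ := mem_image.1 hb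
  rw [filter_filter]
  exact hk a (by simpa using ha)

open Finset in
theorem card_filter_congr_of_inverse {α β : Type*} [Fintype α] [Fintype β] {P : α → Prop}
    {Q : β → Prop} [DecidablePred P] [DecidablePred Q] (f : α → β) (g : β → α)
    (hf : ∀ a, P a → Q (f a) ∧ g (f a) = a) (hg : ∀ b, Q b → P (g b) ∧ f (g b) = b) :
    #{a | P a} = #{b | Q b} :=
  card_nbij' f g (fun a ha => by simpa using (hf a (by simpa using ha)).1)
    (fun b hb => by simpa using (hg b (by simpa using hb)).1)
    (fun a ha => (hf a (by simpa using ha)).2) (fun b hb => (hg b (by simpa using hb)).2)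

namespace SimpleGraph

open Finset

variable {V : Type*} [Fintype V] [DecidableEq V] (G : SimpleGraph V) [DecidableRel G.Adj]

theorem card_triangle_tuples :
    #{t : V × V × V | G.Adj t.1 t.2.1 ∧ G.Adj t.2.1 t.2.2 ∧ G.Adj t.1 t.2.2} =
      6 * triangleCount G := by
  refine card_filter_eq_mul_natCard _ _ (fun t : V × V × V => {t.1, t.2.1, t.2.2}) 6 ?_ ?_
  · intro S
    constructor
    · rintro ⟨hS, hG⟩
      obtain ⟨a, b, c, hab, hac, hbc, rfl⟩ := card_eq_three.1 hS
      exact ⟨(a, b, c), ⟨hG (by simp) (by simp) hab, hG (by simp) (by simp) hbc,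
        hG (by simp) (by simp) hac⟩, rfl⟩
    · rintro ⟨⟨a, b, c⟩, ⟨hab, hbc, hac⟩, rfl⟩
      exact is3Clique_iff.2 ⟨a, b, c, hab, hac, hbc, rfl⟩ |> fun h => ⟨h.2, h.1⟩
  · rintro ⟨a, b, c⟩ ⟨hab, hbc, hac⟩
    dsimp only at hab hbc hac
    have hfib : ({t : V × V × V | (G.Adj t.1 t.2.1 ∧ G.Adj t.2.1 t.2.2 ∧ G.Adj t.1 t.2.2) ∧
        ({t.1, t.2.1, t.2.2} : Finset V) = {a, b, c}} : Finset _) =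
        {(a, b, c), (a, c, b), (b, a, c), (b, c, a), (c, a, b), (c, b, a)} := by
      ext ⟨x, y, z⟩
      simp only [mem_filter_univ, mem_insert, mem_singleton, Prod.mk.injEq]
      constructor
      · rintro ⟨⟨hxy, hyz, hxz⟩, h⟩
        have hx : x ∈ ({a, b, c} : Finset V) := h ▸ by simp
        have hy : y ∈ ({a, b, c} : Finset V) := h ▸ by simp
        have hz : z ∈ ({a, b, c} : Finset V) := h ▸ by simp
        have := hxy.ne
        have := hyz.ne
        have := hxz.ne
        simp only [mem_insert, mem_singleton] at hx hy hz
        grind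
      · have := hab.symm
        have := hbc.symm
        have := hac.symm
        rintro (⟨rfl, rfl, rfl⟩ | ⟨rfl, rfl, rfl⟩ | ⟨rfl, rfl, rfl⟩ | ⟨rfl, rfl, rfl⟩ |
          ⟨rfl, rfl, rfl⟩ | ⟨rfl, rfl, rfl⟩) <;>
        exact ⟨⟨‹_›, ‹_›, ‹_›⟩, by grind⟩
    have := hab.ne
    have := hbc.ne
    have := hac.ne
    rw [hfib]
    grind

theorem card_threePath_tuples :
    #{t : V × V × V | G.Adj t.1 t.2.1 ∧ G.Adj t.1 t.2.2 ∧ t.2.1 ≠ t.2.2} =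
      2 * threePathCount G := by
  refine card_filter_eq_mul_natCard _ _
    (fun t : V × V × V => (t.1, ({t.2.1, t.2.2} : Finset V))) 2 ?_ ?_
  · rintro ⟨v, S⟩
    constructor
    · rintro ⟨hS, hG⟩
      obtain ⟨a, b, hab, rfl⟩ := card_eq_two.1 hS
      exact ⟨(v, a, b), ⟨hG _ (by simp), hG _ (by simp), hab⟩, rfl⟩
    · rintro ⟨⟨v, a, b⟩, ⟨ha, hb, hab⟩, h⟩
      obtain ⟨rfl, rfl⟩ := Prod.mk.inj h
      exact ⟨card_pair hab, by simp [ha, hb]⟩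
  · rintro ⟨v, a, b⟩ ⟨ha, hb, hab⟩
    dsimp only at ha hb hab
    have hfib : ({t : V × V × V | (G.Adj t.1 t.2.1 ∧ G.Adj t.1 t.2.2 ∧ t.2.1 ≠ t.2.2) ∧
        (t.1, ({t.2.1, t.2.2} : Finset V)) = (v, {a, b})} : Finset _) =
        {(v, a, b), (v, b, a)} := by
      ext ⟨u, x, y⟩
      simp only [mem_filter_univ, mem_insert, mem_singleton, Prod.mk.injEq]
      constructor
      · rintro ⟨⟨-, -, hxy⟩, rfl, h⟩
        have hx : x ∈ ({a, b} : Finset V) := h ▸ by simp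
        have hy : y ∈ ({a, b} : Finset V) := h ▸ by simp
        simp only [mem_insert, mem_singleton] at hx hy
        grind
      · rintro (⟨rfl, rfl, rfl⟩ | ⟨rfl, rfl, rfl⟩)
        · exact ⟨⟨ha, hb, hab⟩, rfl, rfl⟩
        · exact ⟨⟨hb, ha, hab.symm⟩, rfl, pair_comm _ _⟩
    rw [hfib]
    exact card_pair (by simp [hab])

theorem card_fourStar_tuples :
    #{t : V × V × V × V | G.Adj t.1 t.2.1 ∧ G.Adj t.1 t.2.2.1 ∧ G.Adj t.1 t.2.2.2 ∧
      t.2.1 ≠ t.2.2.1 ∧ t.2.1 ≠ t.2.2.2 ∧ t.2.2.1 ≠ t.2.2.2} = 6 * fourStarCount G := by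
  refine card_filter_eq_mul_natCard _ _
    (fun t : V × V × V × V => (t.1, ({t.2.1, t.2.2.1, t.2.2.2} : Finset V))) 6 ?_ ?_
  · rintro ⟨v, S⟩
    constructor
    · rintro ⟨hS, hG⟩
      obtain ⟨a, b, c, hab, hac, hbc, rfl⟩ := card_eq_three.1 hS
      exact ⟨(v, a, b, c), ⟨hG _ (by simp), hG _ (by simp), hG _ (by simp), hab, hac, hbc⟩, rfl⟩
    · rintro ⟨⟨v, a, b, c⟩, ⟨ha, hb, hc, hab, hac, hbc⟩, h⟩
      obtain ⟨rfl, rfl⟩ := Prod.mk.inj h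
      exact ⟨card_eq_three.2 ⟨a, b, c, hab, hac, hbc, rfl⟩, by simp [ha, hb, hc]⟩
  · rintro ⟨v, a, b, c⟩ ⟨ha, hb, hc, hab, hac, hbc⟩
    dsimp only at ha hb hc hab hac hbc
    have hfib : ({t : V × V × V × V | (G.Adj t.1 t.2.1 ∧ G.Adj t.1 t.2.2.1 ∧ G.Adj t.1 t.2.2.2 ∧
        t.2.1 ≠ t.2.2.1 ∧ t.2.1 ≠ t.2.2.2 ∧ t.2.2.1 ≠ t.2.2.2) ∧
        (t.1, ({t.2.1, t.2.2.1, t.2.2.2} : Finset V)) = (v, {a, b, c})} : Finset _) =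
        {(v, a, b, c), (v, a, c, b), (v, b, a, c), (v, b, c, a), (v, c, a, b), (v, c, b, a)} := by
      ext ⟨u, x, y, z⟩
      simp only [mem_filter_univ, mem_insert, mem_singleton, Prod.mk.injEq]
      constructor
      · rintro ⟨⟨-, -, -, hxy, hxz, hyz⟩, rfl, h⟩
        have hx : x ∈ ({a, b, c} : Finset V) := h ▸ by simp
        have hy : y ∈ ({a, b, c} : Finset V) := h ▸ by simp
        have hz : z ∈ ({a, b, c} : Finset V) := h ▸ by simp
        simp only [mem_insert, mem_singleton] at hx hy hz
        grind
      · have := hab.symm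
        have := hac.symm
        have := hbc.symm
        rintro (⟨rfl, rfl, rfl, rfl⟩ | ⟨rfl, rfl, rfl, rfl⟩ | ⟨rfl, rfl, rfl, rfl⟩ |
          ⟨rfl, rfl, rfl, rfl⟩ | ⟨rfl, rfl, rfl, rfl⟩ | ⟨rfl, rfl, rfl, rfl⟩) <;>
        exact ⟨⟨‹_›, ‹_›, ‹_›, ‹_›, ‹_›, ‹_›⟩, rfl, by grind⟩
    rw [hfib]
    grind

theorem card_fourPath_tuples :
    #{t : V × V × V × V | ([t.1, t.2.1, t.2.2.1, t.2.2.2] : List V).Nodup ∧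
      G.Adj t.1 t.2.1 ∧ G.Adj t.2.1 t.2.2.1 ∧ G.Adj t.2.2.1 t.2.2.2} = 2 * fourPathCount G := by
  refine card_filter_eq_mul_natCard _ _ (fun t : V × V × V × V =>
    ({s(t.1, t.2.1), s(t.2.1, t.2.2.1), s(t.2.2.1, t.2.2.2)} : Finset (Sym2 V))) 2 ?_ ?_
  · simp [Prod.exists, and_assoc]
  · rintro ⟨a, b, c, d⟩ ⟨hn, hab, hbc, hcd⟩
    dsimp only at hn hab hbc hcd
    have hfib : ({t : V × V × V × V | (([t.1, t.2.1, t.2.2.1, t.2.2.2] : List V).Nodup ∧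
        G.Adj t.1 t.2.1 ∧ G.Adj t.2.1 t.2.2.1 ∧ G.Adj t.2.2.1 t.2.2.2) ∧
        ({s(t.1, t.2.1), s(t.2.1, t.2.2.1), s(t.2.2.1, t.2.2.2)} : Finset (Sym2 V)) =
          {s(a, b), s(b, c), s(c, d)}} : Finset _) = {(a, b, c, d), (d, c, b, a)} := by
      ext ⟨x, y, z, w⟩
      simp only [mem_filter_univ, mem_insert, mem_singleton, Prod.mk.injEq]
      constructor
      · rintro ⟨⟨hm, -⟩, h⟩
        have hxy : s(x, y) ∈ ({s(a, b), s(b, c), s(c, d)} : Finset (Sym2 V)) := h ▸ by simp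
        have hyz : s(y, z) ∈ ({s(a, b), s(b, c), s(c, d)} : Finset (Sym2 V)) := h ▸ by simp
        have hzw : s(z, w) ∈ ({s(a, b), s(b, c), s(c, d)} : Finset (Sym2 V)) := h ▸ by simp
        simp only [mem_insert, mem_singleton, Sym2.eq_iff] at hxy hyz hzw
        simp only [List.nodup_cons, List.mem_cons, List.not_mem_nil, or_false, not_or] at hn hm
        grind
      · rintro (⟨rfl, rfl, rfl, rfl⟩ | ⟨rfl, rfl, rfl, rfl⟩)
        · exact ⟨⟨hn, hab, hbc, hcd⟩, rfl⟩
        · refine ⟨⟨by simpa using List.nodup_reverse.2 hn, hcd.symm, hbc.symm, hab.symm⟩, ?_⟩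
          grind [Sym2.eq_swap]
    rw [hfib]
    exact card_pair (by grind)

theorem card_tadpole_tuples :
    #{t : V × V × V × V | ([t.1, t.2.1, t.2.2.1, t.2.2.2] : List V).Nodup ∧
      G.Adj t.1 t.2.1 ∧ G.Adj t.2.1 t.2.2.1 ∧ G.Adj t.1 t.2.2.1 ∧ G.Adj t.1 t.2.2.2} =
      2 * tadpoleCount G := by
  refine card_filter_eq_mul_natCard _ _ (fun t : V × V × V × V =>
    ({s(t.1, t.2.1), s(t.2.1, t.2.2.1), s(t.1, t.2.2.1), s(t.1, t.2.2.2)} :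
      Finset (Sym2 V))) 2 ?_ ?_
  · simp [Prod.exists, and_assoc]
  · rintro ⟨a, b, c, d⟩ ⟨hn, hab, hbc, hac, had⟩
    dsimp only at hn hab hbc hac had
    have hfib : ({t : V × V × V × V | (([t.1, t.2.1, t.2.2.1, t.2.2.2] : List V).Nodup ∧
        G.Adj t.1 t.2.1 ∧ G.Adj t.2.1 t.2.2.1 ∧ G.Adj t.1 t.2.2.1 ∧ G.Adj t.1 t.2.2.2) ∧
        ({s(t.1, t.2.1), s(t.2.1, t.2.2.1), s(t.1, t.2.2.1), s(t.1, t.2.2.2)} :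
          Finset (Sym2 V)) = {s(a, b), s(b, c), s(a, c), s(a, d)}} : Finset _) =
        {(a, b, c, d), (a, c, b, d)} := by
      ext ⟨x, y, z, w⟩
      simp only [mem_filter_univ, mem_insert, mem_singleton, Prod.mk.injEq]
      constructor
      · rintro ⟨⟨hm, -⟩, h⟩
        have hmem : ∀ e ∈ ({s(x, y), s(y, z), s(x, z), s(x, w)} : Finset (Sym2 V)),
            e ∈ ({s(a, b), s(b, c), s(a, c), s(a, d)} : Finset (Sym2 V)) := fun e he => h ▸ he
        have hxy := hmem s(x, y) (by simp)
        have hyz := hmem s(y, z) (by simp)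
        have hxz := hmem s(x, z) (by simp)
        have hxw := hmem s(x, w) (by simp)
        simp only [mem_insert, mem_singleton, Sym2.eq_iff] at hxy hyz hxz hxw
        simp only [List.nodup_cons, List.mem_cons, List.not_mem_nil, or_false, not_or] at hn hm
        clear hmem h
        grind (splits := 20)
      · rintro (⟨rfl, rfl, rfl, rfl⟩ | ⟨rfl, rfl, rfl, rfl⟩)
        · exact ⟨⟨hn, hab, hbc, hac, had⟩, rfl⟩
        · refine ⟨⟨by grind, hac, hbc.symm, hab, had⟩, ?_⟩
          grind [Sym2.eq_swap]
    rw [hfib]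
    exact card_pair (by grind)

theorem card_fivePath_tuples :
    #{t : V × V × V × V × V |
      ([t.1, t.2.1, t.2.2.1, t.2.2.2.1, t.2.2.2.2] : List V).Nodup ∧
      G.Adj t.1 t.2.1 ∧ G.Adj t.2.1 t.2.2.1 ∧ G.Adj t.2.2.1 t.2.2.2.1 ∧
      G.Adj t.2.2.2.1 t.2.2.2.2} = 2 * fivePathCount G := by
  refine card_filter_eq_mul_natCard _ _ (fun t : V × V × V × V × V =>
    ({s(t.1, t.2.1), s(t.2.1, t.2.2.1), s(t.2.2.1, t.2.2.2.1), s(t.2.2.2.1, t.2.2.2.2)} :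
      Finset (Sym2 V))) 2 ?_ ?_
  · simp [Prod.exists, and_assoc]
  · rintro ⟨a, b, c, d, e⟩ ⟨hn, hab, hbc, hcd, hde⟩
    dsimp only at hn hab hbc hcd hde
    have hfib : ({t : V × V × V × V × V |
        (([t.1, t.2.1, t.2.2.1, t.2.2.2.1, t.2.2.2.2] : List V).Nodup ∧
        G.Adj t.1 t.2.1 ∧ G.Adj t.2.1 t.2.2.1 ∧ G.Adj t.2.2.1 t.2.2.2.1 ∧
        G.Adj t.2.2.2.1 t.2.2.2.2) ∧
        ({s(t.1, t.2.1), s(t.2.1, t.2.2.1), s(t.2.2.1, t.2.2.2.1), s(t.2.2.2.1, t.2.2.2.2)} :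
          Finset (Sym2 V)) = {s(a, b), s(b, c), s(c, d), s(d, e)}} : Finset _) =
        {(a, b, c, d, e), (e, d, c, b, a)} := by
      ext ⟨x, y, z, w, v⟩
      simp only [mem_filter_univ, mem_insert, mem_singleton, Prod.mk.injEq]
      constructor
      · rintro ⟨⟨hm, -⟩, h⟩
        have hmem : ∀ f ∈ ({s(x, y), s(y, z), s(z, w), s(w, v)} : Finset (Sym2 V)),
            f ∈ ({s(a, b), s(b, c), s(c, d), s(d, e)} : Finset (Sym2 V)) := fun f hf => h ▸ hf
        have hxy := hmem s(x, y) (by simp)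
        have hyz := hmem s(y, z) (by simp)
        have hzw := hmem s(z, w) (by simp)
        have hwv := hmem s(w, v) (by simp)
        simp only [mem_insert, mem_singleton, Sym2.eq_iff] at hxy hyz hzw hwv
        simp only [List.nodup_cons, List.mem_cons, List.not_mem_nil, or_false, not_or] at hn hm
        clear hmem h
        grind (splits := 20)
      · rintro (⟨rfl, rfl, rfl, rfl, rfl⟩ | ⟨rfl, rfl, rfl, rfl, rfl⟩)
        · exact ⟨⟨hn, hab, hbc, hcd, hde⟩, rfl⟩
        · refine ⟨⟨by simpa using List.nodup_reverse.2 hn, hde.symm, hcd.symm, hbc.symm,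
            hab.symm⟩, ?_⟩
          grind [Sym2.eq_swap]
    rw [hfib]
    exact card_pair (by grind)

theorem sum_adjMatrix_pow_four_offDiag :
    ∑ p ∈ univ.filter (fun p : V × V => p.1 ≠ p.2), (G.adjMatrix ℕ ^ 4) p.1 p.2 =
      #{t : V × V × V × V × V | t.1 ≠ t.2.2.2.2 ∧ G.Adj t.1 t.2.1 ∧ G.Adj t.2.1 t.2.2.1 ∧
        G.Adj t.2.2.1 t.2.2.2.1 ∧ G.Adj t.2.2.2.1 t.2.2.2.2} := by
  have hpow (u v : V) : (G.adjMatrix ℕ ^ 4) u v = ∑ x, ∑ y, ∑ z,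
      if G.Adj u x ∧ G.Adj x y ∧ G.Adj y z ∧ G.Adj z v then 1 else 0 := by
    rw [show G.adjMatrix ℕ ^ 4 = G.adjMatrix ℕ * (G.adjMatrix ℕ * (G.adjMatrix ℕ * G.adjMatrix ℕ))
      by simp only [pow_succ, pow_zero, one_mul, mul_assoc]]
    simp only [Matrix.mul_apply, adjMatrix_apply, mul_sum, ite_and, ite_mul, one_mul, zero_mul]
  rw [sum_filter, card_filter]
  simp only [Fintype.sum_prod_type, hpow]
  refine sum_congr rfl fun u _ => ?_
  calc
    _ = ∑ v, ∑ x, ∑ y, ∑ z,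
        if u ≠ v ∧ G.Adj u x ∧ G.Adj x y ∧ G.Adj y z ∧ G.Adj z v then 1 else 0 := by
      refine sum_congr rfl fun v _ => ?_
      by_cases huv : u = v <;> simp [huv]
    _ = _ := by
      rw [sum_comm]
      refine sum_congr rfl fun x _ => ?_
      rw [sum_comm]
      refine sum_congr rfl fun y _ => ?_
      rw [sum_comm]

theorem card_walks_of_length_four :
    #{t : V × V × V × V × V | t.1 ≠ t.2.2.2.2 ∧ G.Adj t.1 t.2.1 ∧ G.Adj t.2.1 t.2.2.1 ∧
        G.Adj t.2.2.1 t.2.2.2.1 ∧ G.Adj t.2.2.2.1 t.2.2.2.2} =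
      2 * fivePathCount G + 4 * threePathCount G + 18 * triangleCount G +
        6 * fourStarCount G + 4 * fourPathCount G + 4 * tadpoleCount G := by
  let W : V × V × V × V × V → Prop := fun t => t.1 ≠ t.2.2.2.2 ∧ G.Adj t.1 t.2.1 ∧
    G.Adj t.2.1 t.2.2.1 ∧ G.Adj t.2.2.1 t.2.2.2.1 ∧ G.Adj t.2.2.2.1 t.2.2.2.2
  have hW (x₀ x₁ x₂ x₃ x₄ : V) : W (x₀, x₁, x₂, x₃, x₄) ↔
      x₀ ≠ x₄ ∧ G.Adj x₀ x₁ ∧ G.Adj x₁ x₂ ∧ G.Adj x₂ x₃ ∧ G.Adj x₃ x₄ := Iff.rfl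
  have : DecidablePred W := fun t => by dsimp only [W]; infer_instance
  have hsplit : #{t | W t} =
      #{t | W t ∧ t.1 ≠ t.2.2.1 ∧ t.1 ≠ t.2.2.2.1 ∧ t.2.1 ≠ t.2.2.2.1 ∧ t.2.1 ≠ t.2.2.2.2 ∧
        t.2.2.1 ≠ t.2.2.2.2} +
      #{t | W t ∧ t.1 = t.2.2.1 ∧ t.2.1 ≠ t.2.2.2.1 ∧ t.2.1 ≠ t.2.2.2.2} +
      #{t | W t ∧ t.2.2.1 = t.2.2.2.2 ∧ t.1 ≠ t.2.2.2.1 ∧ t.2.1 ≠ t.2.2.2.1} +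
      #{t | W t ∧ t.2.1 = t.2.2.2.1 ∧ t.1 ≠ t.2.2.1 ∧ t.2.2.1 ≠ t.2.2.2.2} +
      #{t | W t ∧ t.1 = t.2.2.2.1 ∧ t.2.1 ≠ t.2.2.2.2 ∧ t.2.2.1 ≠ t.2.2.2.2} +
      #{t | W t ∧ t.2.1 = t.2.2.2.2 ∧ t.1 ≠ t.2.2.1 ∧ t.1 ≠ t.2.2.2.1} +
      #{t | W t ∧ t.1 = t.2.2.1 ∧ t.2.1 = t.2.2.2.1} +
      #{t | W t ∧ t.2.1 = t.2.2.2.1 ∧ t.2.2.1 = t.2.2.2.2} +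
      #{t | W t ∧ t.1 = t.2.2.1 ∧ t.2.1 = t.2.2.2.2} +
      #{t | W t ∧ t.1 = t.2.2.2.1 ∧ t.2.1 = t.2.2.2.2} +
      #{t | W t ∧ t.1 = t.2.2.2.1 ∧ t.2.2.1 = t.2.2.2.2} := by
    simp only [card_filter, ← sum_add_distrib]
    refine sum_congr rfl ?_
    rintro ⟨x₀, x₁, x₂, x₃, x₄⟩ -
    dsimp only
    by_cases hw : W (x₀, x₁, x₂, x₃, x₄)
    · obtain ⟨h₀₄, h₀₁, h₁₂, h₂₃, h₃₄⟩ := (hW ..).1 hw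
      replace h₀₁ := h₀₁.ne
      replace h₁₂ := h₁₂.ne
      replace h₂₃ := h₂₃.ne
      replace h₃₄ := h₃₄.ne
      simp only [hw, true_and]
      clear hw hW
      by_cases h₀₂ : x₀ = x₂ <;> by_cases h₀₃ : x₀ = x₃ <;> by_cases h₁₃ : x₁ = x₃ <;>
        by_cases h₁₄ : x₁ = x₄ <;> by_cases h₂₄ : x₂ = x₄ <;> simp [*] <;> grind
    · simp [hw]
  have hfive : #{t | W t ∧ t.1 ≠ t.2.2.1 ∧ t.1 ≠ t.2.2.2.1 ∧ t.2.1 ≠ t.2.2.2.1 ∧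
      t.2.1 ≠ t.2.2.2.2 ∧ t.2.2.1 ≠ t.2.2.2.2} = 2 * fivePathCount G := by
    rw [← card_fivePath_tuples]
    congr 1
    ext ⟨x₀, x₁, x₂, x₃, x₄⟩
    simp only [mem_filter_univ, hW, List.nodup_cons, List.mem_cons, List.not_mem_nil, or_false,
      not_or, List.nodup_nil, not_false_eq_true, and_true]
    grind [SimpleGraph.irrefl]
  have hpath₁ : #{t | W t ∧ t.1 = t.2.2.1 ∧ t.2.1 ≠ t.2.2.2.1 ∧ t.2.1 ≠ t.2.2.2.2} =
      2 * fourPathCount G := by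
    rw [← card_fourPath_tuples]
    refine card_filter_congr_of_inverse (fun t => (t.2.1, t.1, t.2.2.2.1, t.2.2.2.2))
      (fun t => (t.2.1, t.1, t.2.1, t.2.2.1, t.2.2.2)) ?_ ?_
    all_goals grind [SimpleGraph.adj_comm, SimpleGraph.irrefl]
  have hpath₂ : #{t | W t ∧ t.2.2.1 = t.2.2.2.2 ∧ t.1 ≠ t.2.2.2.1 ∧ t.2.1 ≠ t.2.2.2.1} =
      2 * fourPathCount G := by
    rw [← card_fourPath_tuples]
    refine card_filter_congr_of_inverse (fun t => (t.1, t.2.1, t.2.2.1, t.2.2.2.1))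
      (fun t => (t.1, t.2.1, t.2.2.1, t.2.2.2, t.2.2.1)) ?_ ?_
    all_goals grind [SimpleGraph.adj_comm, SimpleGraph.irrefl]
  have hstar : #{t | W t ∧ t.2.1 = t.2.2.2.1 ∧ t.1 ≠ t.2.2.1 ∧ t.2.2.1 ≠ t.2.2.2.2} =
      6 * fourStarCount G := by
    rw [← card_fourStar_tuples]
    refine card_filter_congr_of_inverse (fun t => (t.2.1, t.1, t.2.2.1, t.2.2.2.2))
      (fun t => (t.2.1, t.1, t.2.2.1, t.1, t.2.2.2)) ?_ ?_
    all_goals grind [SimpleGraph.adj_comm, SimpleGraph.irrefl]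
  have htadpole₁ : #{t | W t ∧ t.1 = t.2.2.2.1 ∧ t.2.1 ≠ t.2.2.2.2 ∧ t.2.2.1 ≠ t.2.2.2.2} =
      2 * tadpoleCount G := by
    rw [← card_tadpole_tuples]
    refine card_filter_congr_of_inverse (fun t => (t.1, t.2.1, t.2.2.1, t.2.2.2.2))
      (fun t => (t.1, t.2.1, t.2.2.1, t.1, t.2.2.2)) ?_ ?_
    all_goals grind [SimpleGraph.adj_comm, SimpleGraph.irrefl]
  have htadpole₂ : #{t | W t ∧ t.2.1 = t.2.2.2.2 ∧ t.1 ≠ t.2.2.1 ∧ t.1 ≠ t.2.2.2.1} =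
      2 * tadpoleCount G := by
    rw [← card_tadpole_tuples]
    refine card_filter_congr_of_inverse (fun t => (t.2.1, t.2.2.1, t.2.2.2.1, t.1))
      (fun t => (t.2.2.2, t.1, t.2.1, t.2.2.1, t.1)) ?_ ?_
    all_goals grind [SimpleGraph.adj_comm, SimpleGraph.irrefl]
  have hcherry₁ : #{t | W t ∧ t.1 = t.2.2.1 ∧ t.2.1 = t.2.2.2.1} = 2 * threePathCount G := by
    rw [← card_threePath_tuples]
    refine card_filter_congr_of_inverse (fun t => (t.2.1, t.1, t.2.2.2.2))
      (fun t => (t.2.1, t.1, t.2.1, t.1, t.2.2)) ?_ ?_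
    all_goals grind [SimpleGraph.adj_comm, SimpleGraph.irrefl]
  have hcherry₂ : #{t | W t ∧ t.2.1 = t.2.2.2.1 ∧ t.2.2.1 = t.2.2.2.2} =
      2 * threePathCount G := by
    rw [← card_threePath_tuples]
    refine card_filter_congr_of_inverse (fun t => (t.2.1, t.1, t.2.2.2.2))
      (fun t => (t.2.1, t.1, t.2.2, t.1, t.2.2)) ?_ ?_
    all_goals grind [SimpleGraph.adj_comm, SimpleGraph.irrefl]
  have htriangle₁ : #{t | W t ∧ t.1 = t.2.2.1 ∧ t.2.1 = t.2.2.2.2} = 6 * triangleCount G := by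
    rw [← card_triangle_tuples]
    refine card_filter_congr_of_inverse (fun t => (t.1, t.2.1, t.2.2.2.1))
      (fun t => (t.1, t.2.1, t.1, t.2.2, t.2.1)) ?_ ?_
    all_goals grind [SimpleGraph.adj_comm, SimpleGraph.irrefl]
  have htriangle₂ : #{t | W t ∧ t.1 = t.2.2.2.1 ∧ t.2.1 = t.2.2.2.2} = 6 * triangleCount G := by
    rw [← card_triangle_tuples]
    refine card_filter_congr_of_inverse (fun t => (t.1, t.2.1, t.2.2.1))
      (fun t => (t.1, t.2.1, t.2.2, t.1, t.2.1)) ?_ ?_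
    all_goals grind [SimpleGraph.adj_comm, SimpleGraph.irrefl]
  have htriangle₃ : #{t | W t ∧ t.1 = t.2.2.2.1 ∧ t.2.2.1 = t.2.2.2.2} =
      6 * triangleCount G := by
    rw [← card_triangle_tuples]
    refine card_filter_congr_of_inverse (fun t => (t.1, t.2.1, t.2.2.1))
      (fun t => (t.1, t.2.1, t.2.2, t.1, t.2.2)) ?_ ?_
    all_goals grind [SimpleGraph.adj_comm, SimpleGraph.irrefl]
  trans #{t | W t}
  · congr
  rw [hsplit, hfive, hpath₁, hpath₂, hstar, htadpole₁, htadpole₂, hcherry₁, hcherry₂, htriangle₁,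
    htriangle₂, htriangle₃]
  ring

end SimpleGraph

theorem stmt11 {V : Type*} [Fintype V] [DecidableEq V] (G : SimpleGraph V)
    [DecidableRel G.Adj] :
    ∑ p ∈ Finset.univ.filter (fun p : V × V => p.1 ≠ p.2), (G.adjMatrix ℕ ^ 4) p.1 p.2 =
      2 * fivePathCount G + 4 * threePathCount G + 18 * triangleCount G +
        6 * fourStarCount G + 4 * fourPathCount G + 4 * tadpoleCount G := by
  rw [G.sum_adjMatrix_pow_four_offDiag, G.card_walks_of_length_four]
end

section
/- Let G be a finite simple undirected graph. For vertices u ≠ v, let B_{u,v} be the adjacency matrix of the subgraph of G induced by N(u) ∩ N(v), the set of common neighbors of u and v. Then 120 times the number of 5-cliques of G equals ∑_u ∑_{v ∈ N(u)} tr(B_{u,v}³). -/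
/-- The number of 5-cliques of `G`: 5-element sets of pairwise adjacent vertices. -/
noncomputable def fiveCliqueCount {V : Type*} (G : SimpleGraph V) : ℕ :=
  Nat.card {S : Finset V // S.card = 5 ∧ G.IsClique ↑S}

theorem Fin.sum_arrow_succ {V M : Type*} [Fintype V] [AddCommMonoid M] {n : ℕ}
    (F : (Fin (n + 1) → V) → M) :
    ∑ f, F f = ∑ a, ∑ g : Fin n → V, F (Fin.cons a g) := by
  rw [← (Fin.consEquiv fun _ : Fin (n + 1) => V).sum_comp, Fintype.sum_prod_type]
  rfl

theorem Finset.card_injective_image_eq {V : Type*} [Fintype V] [DecidableEq V] {n : ℕ}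
    (S : Finset V) (hS : S.card = n) :
    Nat.card {f : Fin n → V // Function.Injective f ∧ Finset.univ.image f = S} =
      n.factorial := by
  let e : {f : Fin n → V // Function.Injective f ∧ Finset.univ.image f = S} ≃ (Fin n ≃ S) :=
    { toFun := fun f => Equiv.ofBijective
        (fun i => ⟨f.1 i, f.2.2.subset (Finset.mem_image_of_mem _ (Finset.mem_univ i))⟩)
        ⟨fun i j h => f.2.1 (congrArg Subtype.val h), fun ⟨x, hx⟩ => by
          obtain ⟨i, -, hi⟩ := Finset.mem_image.mp (f.2.2.symm.subset hx)
          exact ⟨i, Subtype.ext hi⟩⟩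
      invFun := fun g => ⟨fun i => g i, fun i j h => g.injective (Subtype.ext h), by
        ext x
        simp only [Finset.mem_image, Finset.mem_univ, true_and]
        exact ⟨fun ⟨i, hi⟩ => hi ▸ (g i).2, fun hx => ⟨g.symm ⟨x, hx⟩, by simp⟩⟩⟩
      left_inv := fun f => rfl
      right_inv := fun g => by ext; rfl }
  rw [Nat.card_congr e, Nat.card_eq_fintype_card,
    Fintype.card_equiv (Fintype.equivOfCardEq (by simp [hS])), Fintype.card_fin]

open Classical in
theorem SimpleGraph.card_pairwise_adj_tuples {V : Type*} [Fintype V]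
    (G : SimpleGraph V) (n : ℕ) :
    (Finset.univ.filter fun f : Fin n → V => Pairwise fun i j => G.Adj (f i) (f j)).card =
      n.factorial * Nat.card {S : Finset V // S.card = n ∧ G.IsClique ↑S} := by
  have hinj {f : Fin n → V} (hf : Pairwise fun i j => G.Adj (f i) (f j)) :
      Function.Injective f := fun i j hij => by
    by_contra hne
    exact (hf hne).ne hij
  rw [Nat.subtype_card (Finset.univ.filter fun S : Finset V => S.card = n ∧ G.IsClique ↑S)
      (by simp),
    Finset.card_eq_sum_card_fiberwise (f := fun f => Finset.univ.image f)
      (t := Finset.univ.filter fun S : Finset V => S.card = n ∧ G.IsClique ↑S),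
    Finset.sum_const_nat (m := n.factorial), mul_comm]
  · intro S hS
    obtain ⟨hcard, hclique⟩ := (Finset.mem_filter.mp hS).2
    rw [← S.card_injective_image_eq hcard]
    refine (Nat.subtype_card _ fun f => ?_).symm
    simp only [Finset.mem_filter, Finset.mem_univ, true_and]
    refine and_congr_left fun hf => ⟨hinj, fun h i j hij => hclique ?_ ?_ (h.ne hij)⟩ <;>
      simp [← hf]
  · intro f hf
    have hf := (Finset.mem_filter.mp (Finset.mem_coe.mp hf)).2
    simp only [Finset.coe_filter, Finset.mem_univ, true_and, Set.mem_ofPred_eq]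
    refine ⟨by simp [Finset.card_image_of_injective _ (hinj hf)], ?_⟩
    intro x hx y hy hxy
    simp only [Finset.coe_image, Finset.coe_univ, Set.image_univ, Set.mem_range] at hx hy
    obtain ⟨i, rfl⟩ := hx
    obtain ⟨j, rfl⟩ := hy
    exact hf fun h => hxy (congrArg f h)

theorem SimpleGraph.pairwise_adj_cons_iff {V : Type*} (G : SimpleGraph V) {n : ℕ} (a : V)
    (f : Fin n → V) :
    (Pairwise fun i j : Fin (n + 1) =>
      G.Adj ((Fin.cons a f : Fin (n + 1) → V) i) ((Fin.cons a f : Fin (n + 1) → V) j)) ↔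
      (∀ i, G.Adj a (f i)) ∧ Pairwise fun i j => G.Adj (f i) (f j) := by
  simp only [Pairwise, Fin.forall_fin_succ, Fin.cons_zero, Fin.cons_succ, ne_eq, Fin.succ_inj,
    Fin.succ_ne_zero, (Fin.succ_ne_zero _).symm, not_true_eq_false, not_false_eq_true,
    forall_const, IsEmpty.forall_iff, true_and]
  exact ⟨fun h => ⟨h.1, fun i j hij => (h.2 i).2 j hij⟩,
    fun h => ⟨h.1, fun i => ⟨(h.1 i).symm, fun j hij => h.2 hij⟩⟩⟩

theorem SimpleGraph.trace_adjMatrix_induce_pow_three {V : Type*} [Fintype V] [DecidableEq V]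
    (G : SimpleGraph V) [DecidableRel G.Adj] (s : Set V) [DecidablePred (· ∈ s)] [Fintype s] :
    Matrix.trace ((G.induce s).adjMatrix ℕ ^ 3) =
      ∑ x, ∑ y, ∑ z, if (x ∈ s ∧ y ∈ s ∧ z ∈ s) ∧ G.Adj x y ∧ G.Adj x z ∧ G.Adj y z
        then 1 else 0 := by
  have hsum (F : V → ℕ) : ∑ x : s, F x = ∑ x, if x ∈ s then F x else 0 := by
    rw [← Finset.sum_filter]
    exact (Finset.sum_subtype _ (by simp) F).symm
  have htrace : Matrix.trace ((G.induce s).adjMatrix ℕ ^ 3) =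
      ∑ x : s, ∑ y : s, ∑ z : s,
        if G.Adj x y ∧ G.Adj x z ∧ G.Adj y z then 1 else 0 := by
    simp only [Matrix.trace, Matrix.diag_apply, pow_succ, pow_zero, one_mul, Matrix.mul_apply,
      Finset.sum_mul, SimpleGraph.adjMatrix_apply, SimpleGraph.comap_adj,
      Function.Embedding.subtype_apply]
    refine Finset.sum_congr rfl fun x _ => ?_
    rw [Finset.sum_comm]
    refine Finset.sum_congr rfl fun y _ => Finset.sum_congr rfl fun z _ => ?_
    simp only [G.adj_comm z x]
    split_ifs <;> simp_all
  rw [htrace]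
  have hz (x y : V) := hsum fun z => if G.Adj x y ∧ G.Adj x z ∧ G.Adj y z then 1 else 0
  have hy (x : V) := hsum fun y => ∑ z, if z ∈ s then
    if G.Adj x y ∧ G.Adj x z ∧ G.Adj y z then 1 else 0 else 0
  have hx := hsum fun x => ∑ y, if y ∈ s then ∑ z, if z ∈ s then
    if G.Adj x y ∧ G.Adj x z ∧ G.Adj y z then 1 else 0 else 0 else 0
  simp only [hz, hy, hx]
  refine Finset.sum_congr rfl fun x _ => ?_
  by_cases hx : x ∈ s <;> simp only [hx, if_true, if_false, true_and, false_and,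
    Finset.sum_const_zero]
  refine Finset.sum_congr rfl fun y _ => ?_
  by_cases hy : y ∈ s <;> simp [hy, ← ite_and]

theorem stmt12 {V : Type*} [Fintype V] [DecidableEq V] (G : SimpleGraph V)
    [DecidableRel G.Adj] :
    120 * fiveCliqueCount G =
      ∑ u, ∑ v ∈ G.neighborFinset u,
        Matrix.trace ((G.induce (G.neighborSet u ∩ G.neighborSet v)).adjMatrix ℕ ^ 3) := by
  have hcount := G.card_pairwise_adj_tuples 5
  rw [Finset.card_filter] at hcount
  simp only [Fin.sum_arrow_succ, Fintype.sum_unique] at hcount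
  rw [fiveCliqueCount, show 120 = Nat.factorial 5 from rfl, ← hcount]
  refine Finset.sum_congr rfl fun u _ => ?_
  rw [SimpleGraph.neighborFinset_eq_filter, Finset.sum_filter]
  refine Finset.sum_congr rfl fun v _ => ?_
  have hpair (x y z : V) (t : Fin 0 → V) :
      (Pairwise fun i j : Fin 5 => G.Adj
        ((Fin.cons u (Fin.cons v (Fin.cons x (Fin.cons y (Fin.cons z t)))) : Fin 5 → V) i)
        ((Fin.cons u (Fin.cons v (Fin.cons x (Fin.cons y (Fin.cons z t)))) : Fin 5 → V) j)) ↔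
      G.Adj u v ∧ ((x ∈ G.neighborSet u ∩ G.neighborSet v ∧
        y ∈ G.neighborSet u ∩ G.neighborSet v ∧ z ∈ G.neighborSet u ∩ G.neighborSet v) ∧
        G.Adj x y ∧ G.Adj x z ∧ G.Adj y z) := by
    simp only [G.pairwise_adj_cons_iff, Fin.forall_fin_succ, Fin.cons_zero, Fin.cons_succ,
      Set.mem_inter_iff, SimpleGraph.mem_neighborSet, IsEmpty.forall_iff, Subsingleton.pairwise]
    tauto
  simp only [hpair, G.trace_adjMatrix_induce_pow_three]
  by_cases h : G.Adj u v <;> simp [h]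
end

section
/- For an integer n ≥ 6, let G_n be the simple undirected graph on vertex set {0, 1, …, n−1} in which the vertices 0, 1, 2, 3 are pairwise adjacent, vertices i and i+1 are adjacent for every i with 3 ≤ i ≤ n−2, and there are no other edges. Then G_n has exactly one 4-clique and exactly n + 22 4-vertex tree subgraphs, so C(4) = 16/(n + 22); moreover 12/(n + 10) ≥ 16/(n + 22) holds if and only if n ≤ 26, with equality exactly when n = 26. -/
/-- The graph on `{0, 1, …, n-1}` in which `0, 1, 2, 3` are pairwise adjacent, `i` and `i + 1`
are adjacent for every `3 ≤ i ≤ n - 2`, and there are no other edges. -/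
def chainK4 (n : ℕ) : SimpleGraph (Fin n) :=
  SimpleGraph.fromRel (fun i j =>
    ((i : ℕ) < 4 ∧ (j : ℕ) < 4) ∨ ((j : ℕ) = (i : ℕ) + 1 ∧ 3 ≤ (i : ℕ)))

/-- The set of end points of a finite set of edges. -/
def edgeSupport {V : Type*} [DecidableEq V] (E : Finset (Sym2 V)) : Finset V :=
  E.biUnion Sym2.toFinset

/-- The edges in `E` form a tree with vertex set `S`. -/
def IsTreeOn_s14 {V : Type*} (S : Finset V) (E : Finset (Sym2 V)) : Prop :=
  (∀ e ∈ E, ∀ v ∈ e, v ∈ S) ∧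
  (∀ u ∈ S, ∀ v ∈ S, (SimpleGraph.fromEdgeSet (↑E : Set (Sym2 V))).Reachable u v) ∧
  (SimpleGraph.fromEdgeSet (↑E : Set (Sym2 V))).IsAcyclic

section
variable {V : Type*} [DecidableEq V]

lemma mem_edgeSupport {E : Finset (Sym2 V)} {v : V} :
    v ∈ edgeSupport E ↔ ∃ e ∈ E, v ∈ e := by
  simp [edgeSupport, Sym2.mem_toFinset]

lemma edgeSupport_insert (a b : V) (E : Finset (Sym2 V)) :
    edgeSupport (insert s(a, b) E) = insert a (insert b (edgeSupport E)) := by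
  ext v
  simp [edgeSupport, Sym2.toFinset_mk_eq]

lemma edgeSupport_singleton (a b : V) :
    edgeSupport {s(a, b)} = {a, b} := by
  simp [edgeSupport, Sym2.toFinset_mk_eq]

omit [DecidableEq V] in
lemma isTreeOn_singleton (a : V) : IsTreeOn_s14 {a} ∅ := by
  refine ⟨by simp, by simp, by simp⟩

lemma IsTreeOn_s14.insert_leaf {S : Finset V} {E : Finset (Sym2 V)} (h : IsTreeOn_s14 S E)
    {u v : V} (hu : u ∈ S) (hv : v ∉ S) : IsTreeOn_s14 (insert v S) (insert s(u, v) E) := by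
  obtain ⟨hin, hreach, hac⟩ := h
  have huv : u ≠ v := fun h => hv (h ▸ hu)
  have hE : SimpleGraph.fromEdgeSet (↑(insert s(u, v) E) : Set (Sym2 V)) =
      SimpleGraph.fromEdgeSet (↑E : Set (Sym2 V)) ⊔ SimpleGraph.edge u v := by
    rw [SimpleGraph.edge, ← SimpleGraph.fromEdgeSet_union, Finset.coe_insert, Set.insert_eq,
      Set.union_comm]
  refine ⟨?_, ?_, ?_⟩
  · intro e he x hx
    rcases Finset.mem_insert.1 he with rfl | he
    · rcases Sym2.mem_iff.1 hx with rfl | rfl <;> simp [hu]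
    · exact Finset.mem_insert_of_mem (hin e he x hx)
  · have hroot : ∀ x ∈ insert v S,
        (SimpleGraph.fromEdgeSet (↑(insert s(u, v) E) : Set (Sym2 V))).Reachable u x := by
      intro x hx
      rcases Finset.mem_insert.1 hx with rfl | hx
      · exact SimpleGraph.Adj.reachable (by simp [huv])
      · exact (hreach u hu x hx).mono (hE ▸ le_sup_left)
    exact fun x hx y hy => (hroot x hx).symm.trans (hroot y hy)
  · rw [hE]
    refine hac.sup_edge_of_not_reachable
      (SimpleGraph.not_reachable_of_neighborSet_right_eq_empty huv ?_)
    ext x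
    simp only [SimpleGraph.mem_neighborSet, SimpleGraph.fromEdgeSet_adj, Set.mem_empty_iff_false,
      iff_false]
    exact fun hx => hv (hin _ hx.1 v (by simp))

lemma IsTreeOn_s14.eq_edgeSupport {S : Finset V} {E : Finset (Sym2 V)} (h : IsTreeOn_s14 S E)
    (hS : 1 < S.card) : S = edgeSupport E := by
  obtain ⟨hin, hreach, -⟩ := h
  ext v
  rw [mem_edgeSupport]
  refine ⟨fun hv => ?_, fun ⟨e, he, hve⟩ => hin e he v hve⟩
  obtain ⟨u, hu, huv⟩ := Finset.exists_mem_ne hS v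
  by_contra! hno
  refine SimpleGraph.not_reachable_of_neighborSet_right_eq_empty huv ?_ (hreach u hu v hv)
  ext x
  simp only [SimpleGraph.mem_neighborSet, SimpleGraph.fromEdgeSet_adj, Set.mem_empty_iff_false,
    iff_false]
  exact fun hx => hno _ hx.1 (by simp)

lemma isTreeOn_of_common_vertex {e f g : Sym2 V} {b : V} (hbe : b ∈ e) (hbf : b ∈ f)
    (hef : e ≠ f) (he : ¬ e.IsDiag) (hf : ¬ f.IsDiag) (hg : ¬ g.IsDiag)
    (hcard : (edgeSupport {e, f, g}).card = 4) :
    IsTreeOn_s14 (edgeSupport {e, f, g}) {e, f, g} := by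
  obtain ⟨a, rfl⟩ := hbe
  obtain ⟨c, rfl⟩ := hbf
  induction g with | _ x y =>
  rw [Sym2.mk_isDiag_iff] at he hf hg
  have hac : a ≠ c := fun h => hef (h ▸ rfl)
  have hT : IsTreeOn_s14 {c, a, b} {s(b, c), s(b, a)} :=
    ((isTreeOn_singleton b).insert_leaf (by simp) (by simpa using Ne.symm he)).insert_leaf
      (u := b) (v := c) (by simp) (by simp [Ne.symm hac, Ne.symm hf])
  have hE : ({s(b, a), s(b, c), s(x, y)} : Finset (Sym2 V)) =
      insert s(x, y) {s(b, c), s(b, a)} := by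
    ext; simp; tauto
  have hS : edgeSupport ({s(b, a), s(b, c), s(x, y)} : Finset (Sym2 V)) =
      insert x (insert y {c, a, b}) := by
    rw [hE, edgeSupport_insert, edgeSupport_insert, edgeSupport_singleton]
    ext; simp; tauto
  have h3 : ({c, a, b} : Finset V).card = 3 :=
    Finset.card_eq_three.2 ⟨c, a, b, hac.symm, Ne.symm hf, Ne.symm he, rfl⟩
  rw [hS] at hcard ⊢
  rw [hE]
  by_cases hx : x ∈ ({c, a, b} : Finset V)
  · rw [Finset.insert_eq_of_mem (Finset.mem_insert_of_mem hx)] at hcard ⊢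
    have hy : y ∉ ({c, a, b} : Finset V) := fun hy => by
      rw [Finset.insert_eq_of_mem hy] at hcard; omega
    exact hT.insert_leaf hx hy
  · have hy : y ∈ ({c, a, b} : Finset V) := by
      by_contra hy
      rw [Finset.card_insert_of_notMem (by simp only [Finset.mem_insert (a := x) (b := y), not_or]
                                           exact ⟨hg, hx⟩),
        Finset.card_insert_of_notMem hy] at hcard
      omega
    rw [Finset.insert_eq_of_mem hy] at hcard ⊢
    rw [Sym2.eq_swap]
    exact hT.insert_leaf hy hx

lemma isTreeOn_edgeSupport {E : Finset (Sym2 V)} (hE : E.card = 3) (hdiag : ∀ e ∈ E, ¬ e.IsDiag)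
    (hcard : (edgeSupport E).card = 4) : IsTreeOn_s14 (edgeSupport E) E := by
  obtain ⟨e, f, g, hef, heg, hfg, rfl⟩ := Finset.card_eq_three.1 hE
  have he := hdiag e (by simp)
  have hf := hdiag f (by simp)
  have hg := hdiag g (by simp)
  by_cases h1 : ∃ b, b ∈ e ∧ b ∈ f
  · obtain ⟨b, hb, hb'⟩ := h1
    exact isTreeOn_of_common_vertex hb hb' hef he hf hg hcard
  by_cases h2 : ∃ b, b ∈ e ∧ b ∈ g
  · obtain ⟨b, hb, hb'⟩ := h2
    rw [show ({e, f, g} : Finset (Sym2 V)) = {e, g, f} by ext; simp; tauto] at hcard ⊢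
    exact isTreeOn_of_common_vertex hb hb' heg he hg hf hcard
  by_cases h3 : ∃ b, b ∈ f ∧ b ∈ g
  · obtain ⟨b, hb, hb'⟩ := h3
    rw [show ({e, f, g} : Finset (Sym2 V)) = {f, g, e} by ext; simp; tauto] at hcard ⊢
    exact isTreeOn_of_common_vertex hb hb' hfg hf hg he hcard
  push Not at h1 h2 h3
  have key : (edgeSupport {e, f, g}).card = 6 := by
    rw [edgeSupport, Finset.card_biUnion]
    · rw [Finset.sum_congr rfl fun x hx => Sym2.card_toFinset_of_not_isDiag x (hdiag x hx)]
      rw [Finset.sum_const, hE, smul_eq_mul]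
    · have hdisj : ∀ x y : Sym2 V, (∀ b, b ∈ x → b ∉ y) → Disjoint x.toFinset y.toFinset :=
        fun x y h => Finset.disjoint_left.2 fun b => by simpa [Sym2.mem_toFinset] using h b
      have h12 := hdisj _ _ h1
      have h13 := hdisj _ _ h2
      have h23 := hdisj _ _ h3
      intro x hx y hy hxy
      rw [Finset.mem_coe, Finset.mem_insert, Finset.mem_insert, Finset.mem_singleton] at hx hy
      rcases hx with rfl | rfl | rfl <;> rcases hy with rfl | rfl | rfl <;>
        first | exact absurd rfl hxy | assumption | (apply Disjoint.symm; assumption)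
  omega

/-- The edge sets of the three-edge subgraphs with four non-isolated vertices. -/
def treeEdgeSets (K : Finset (Sym2 V)) : Finset (Finset (Sym2 V)) :=
  {E ∈ K.powersetCard 3 | (edgeSupport E).card = 4}

lemma treeSubCount_four (G : SimpleGraph V) (K : Finset (Sym2 V))
    (hK : (K : Set (Sym2 V)) = G.edgeSet) :
    treeSubCount G 4 = (treeEdgeSets K).card := by
  have hmem (e) : e ∈ K ↔ e ∈ G.edgeSet := by rw [← hK, Finset.mem_coe]
  rw [← Finset.card_image_of_injective (treeEdgeSets K) (f := fun E => (edgeSupport E, E))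
    fun E F h => (Prod.ext_iff.1 h).2, treeSubCount]
  refine Nat.subtype_card _ fun ⟨S, E⟩ => ?_
  simp only [Finset.mem_image, treeEdgeSets, Finset.mem_filter, Finset.mem_powersetCard,
    Prod.mk.injEq]
  constructor
  · rintro ⟨E, ⟨⟨hEK, hE⟩, hS⟩, rfl, rfl⟩
    exact ⟨hS, hE, fun e he => (hmem e).1 (hEK he), isTreeOn_edgeSupport hE
      (fun e he => G.not_isDiag_of_mem_edgeSet ((hmem e).1 (hEK he))) hS⟩
  · rintro ⟨hS, hE, hEG, hT⟩
    have hSE : S = edgeSupport E := IsTreeOn_s14.eq_edgeSupport hT (by omega)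
    exact ⟨E, ⟨⟨fun e he => (hmem e).2 (hEG e he), hE⟩, hSE ▸ hS⟩, hSE.symm, rfl⟩

lemma edgeSupport_map {W : Type*} [DecidableEq W] (f : V ↪ W) (E : Finset (Sym2 V)) :
    edgeSupport (E.map f.sym2Map) = (edgeSupport E).map f := by
  ext w
  simp only [mem_edgeSupport, Finset.mem_map]
  constructor
  · rintro ⟨_, ⟨e, he, rfl⟩, hw⟩
    obtain ⟨v, hv, rfl⟩ := Sym2.mem_map.1 hw
    exact ⟨v, ⟨e, he, hv⟩, rfl⟩
  · rintro ⟨v, ⟨e, he, hv⟩, rfl⟩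
    exact ⟨_, ⟨e, he, rfl⟩, Sym2.mem_map.2 ⟨v, hv, rfl⟩⟩

lemma card_treeEdgeSets_map {W : Type*} [DecidableEq W] (f : V ↪ W) (K : Finset (Sym2 V)) :
    (treeEdgeSets (K.map f.sym2Map)).card = (treeEdgeSets K).card := by
  rw [treeEdgeSets, Finset.powersetCard_map, Finset.filter_map, Finset.card_map, treeEdgeSets]
  congr 1
  ext E
  simp [edgeSupport_map]

end

/-- The edges of `chainK4 n`, as pairs of natural numbers, given by adding `k` path edges to the
complete graph on `{0, 1, 2, 3}`. -/
def chainEdges : ℕ → Finset (Sym2 ℕ)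
  | 0 => {s(0, 1), s(0, 2), s(0, 3), s(1, 2), s(1, 3), s(2, 3)}
  | k + 1 => insert s(k + 3, k + 4) (chainEdges k)

lemma card_treeEdgeSets_chainEdges_two : (treeEdgeSets (chainEdges 2)).card = 28 := by
  decide +kernel

lemma mem_chainEdges (k a b : ℕ) : s(a, b) ∈ chainEdges k ↔ a ≠ b ∧
    ((a < 4 ∧ b < 4) ∨ (b = a + 1 ∧ 3 ≤ a ∧ b < k + 4) ∨ (a = b + 1 ∧ 3 ≤ b ∧ a < k + 4)) := by
  induction k with
  | zero =>
    simp only [chainEdges, Finset.mem_insert, Finset.mem_singleton, Sym2.eq_iff]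
    omega
  | succ k ih =>
    rw [chainEdges, Finset.mem_insert, ih, Sym2.eq_iff]
    omega

lemma treeEdgeSets_chainEdges_new (k : ℕ) :
    {E ∈ ((chainEdges (k + 2)).powersetCard 2).image (insert s(k + 5, k + 6)) |
      (edgeSupport E).card = 4} = {{s(k + 5, k + 6), s(k + 4, k + 5), s(k + 3, k + 4)}} := by
  ext E
  simp only [Finset.mem_filter, Finset.mem_image, Finset.mem_powersetCard, Finset.mem_singleton]
  constructor
  · rintro ⟨⟨F, ⟨hFK, hF⟩, rfl⟩, hcard⟩
    obtain ⟨e, f, hef, rfl⟩ := Finset.card_eq_two.1 hF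
    have he := hFK (Finset.mem_insert_self e {f})
    have hf := hFK (Finset.mem_insert_of_mem (Finset.mem_singleton_self f))
    clear hFK hF
    induction e with | _ a b =>
    induction f with | _ c d =>
    rw [mem_chainEdges] at he hf
    have ha : a ≤ k + 5 ∧ b ≤ k + 5 := by clear hf; omega
    have hc : c ≤ k + 5 ∧ d ≤ k + 5 := by clear he; omega
    rw [edgeSupport_insert, edgeSupport_insert, edgeSupport_singleton] at hcard
    have few (p q r : ℕ) (hp : p = a ∨ p = b ∨ p = c ∨ p = d) (hq : q = a ∨ q = b ∨ q = c ∨ q = d)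
        (hr : r = a ∨ r = b ∨ r = c ∨ r = d) :
        ¬ (p ≠ q ∧ p ≠ r ∧ q ≠ r ∧ p < k + 5 ∧ q < k + 5 ∧ r < k + 5) := by
      rintro ⟨h1, h2, h3, h4, h5, h6⟩
      have hsub : ({p, q, r, k + 5, k + 6} : Finset ℕ) ⊆ {k + 5, k + 6, a, b, c, d} := by
        intro x
        simp only [Finset.mem_insert, Finset.mem_singleton]
        omega
      have hle := Finset.card_le_card hsub
      rw [hcard, Finset.card_insert_of_notMem (by simp; omega),
        Finset.card_insert_of_notMem (by simp; omega),
        Finset.card_insert_of_notMem (by simp; omega),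
        Finset.card_insert_of_notMem (by simp), Finset.card_singleton] at hle
      omega
    have habc := few a b c (by simp) (by simp) (by simp)
    have habd := few a b d (by simp) (by simp) (by simp)
    have hacd := few a c d (by simp) (by simp) (by simp)
    have hbcd := few b c d (by simp) (by simp) (by simp)
    rw [Ne, Sym2.eq_iff] at hef
    have key : (s(a, b) = s(k + 4, k + 5) ∧ s(c, d) = s(k + 3, k + 4)) ∨
        (s(c, d) = s(k + 4, k + 5) ∧ s(a, b) = s(k + 3, k + 4)) := by
      simp only [Sym2.eq_iff]
      clear few hcard
      have htop : a = k + 5 ∨ b = k + 5 ∨ c = k + 5 ∨ d = k + 5 := by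
        by_contra! hno
        have hc' : a = c ∨ b = c := by clear hf habd hacd hbcd hef; omega
        have hd' : a = d ∨ b = d := by clear hf habc hacd hbcd hef; omega
        clear habc habd hacd hbcd he
        omega
      rcases htop with rfl | rfl | rfl | rfl
      · obtain rfl : b = k + 4 := by clear hf habc habd hacd hbcd hef; omega
        have h4 : c = k + 4 ∨ d = k + 4 := by clear habc habd hacd he; omega
        rcases h4 with rfl | rfl <;> clear habc habd hacd hbcd he <;> omega
      · obtain rfl : a = k + 4 := by clear hf habc habd hacd hbcd hef; omega
        have h4 : c = k + 4 ∨ d = k + 4 := by clear habc habd hbcd he; omega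
        rcases h4 with rfl | rfl <;> clear habc habd hacd hbcd he <;> omega
      · obtain rfl : d = k + 4 := by clear he habc habd hacd hbcd hef; omega
        have h4 : a = k + 4 ∨ b = k + 4 := by clear habc hacd hbcd hf; omega
        rcases h4 with rfl | rfl <;> clear habc habd hacd hbcd hf <;> omega
      · obtain rfl : c = k + 4 := by clear he habc habd hacd hbcd hef; omega
        have h4 : a = k + 4 ∨ b = k + 4 := by clear habd hacd hbcd hf; omega
        rcases h4 with rfl | rfl <;> clear habc habd hacd hbcd hf <;> omega
    rcases key with ⟨h1, h2⟩ | ⟨h1, h2⟩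
    · rw [h1, h2]
    · rw [h1, h2, Finset.pair_comm]
  · rintro rfl
    refine ⟨⟨{s(k + 4, k + 5), s(k + 3, k + 4)}, ⟨?_, ?_⟩, rfl⟩, ?_⟩
    · simp only [Finset.insert_subset_iff, Finset.singleton_subset_iff, mem_chainEdges,
        true_and]
      omega
    · exact Finset.card_pair (by simp)
    · rw [edgeSupport_insert, edgeSupport_insert, edgeSupport_singleton]
      have : ({k + 5, k + 6, k + 4, k + 5, k + 3, k + 4} : Finset ℕ) =
          Finset.Ico (k + 3) (k + 7) := by
        ext x
        simp only [Finset.mem_insert, Finset.mem_singleton, Finset.mem_Ico]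
        omega
      rw [this, Nat.card_Ico]
      omega

lemma card_treeEdgeSets_chainEdges (k : ℕ) : (treeEdgeSets (chainEdges (k + 2))).card = k + 28 := by
  induction k with
  | zero => exact card_treeEdgeSets_chainEdges_two
  | succ k ih =>
    have hnew : s(k + 5, k + 6) ∉ chainEdges (k + 2) := by
      rw [mem_chainEdges]
      omega
    rw [treeEdgeSets, show k + 1 + 2 = k + 2 + 1 by ring, chainEdges,
      Finset.powersetCard_succ_insert hnew, Finset.filter_union, treeEdgeSets_chainEdges_new,
      Finset.card_union_of_disjoint]
    · rw [← treeEdgeSets, ih, Finset.card_singleton]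
    · rw [Finset.disjoint_singleton_right, Finset.mem_filter, Finset.mem_powersetCard]
      exact fun h => hnew (h.1.1 (Finset.mem_insert_self _ _))

lemma chainK4_adj {n : ℕ} {i j : Fin n} : (chainK4 n).Adj i j ↔ (i : ℕ) ≠ j ∧
    (((i : ℕ) < 4 ∧ (j : ℕ) < 4) ∨ ((j : ℕ) = i + 1 ∧ 3 ≤ (i : ℕ)) ∨
      ((i : ℕ) = j + 1 ∧ 3 ≤ (j : ℕ))) := by
  rw [chainK4, SimpleGraph.fromRel_adj, Ne, Fin.ext_iff]
  omega

lemma treeSubCount_chainK4 (n : ℕ) (hn : 6 ≤ n) : treeSubCount (chainK4 n) 4 = n + 22 := by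
  classical
  obtain ⟨k, rfl⟩ := Nat.exists_eq_add_of_le' hn
  have hmap : (chainK4 (k + 6)).edgeFinset.map Fin.valEmbedding.sym2Map = chainEdges (k + 2) := by
    ext e
    induction e with | _ a b =>
    rw [mem_chainEdges, Finset.mem_map]
    constructor
    · rintro ⟨e, he, heq⟩
      induction e with | _ i j =>
      rw [SimpleGraph.mem_edgeFinset, SimpleGraph.mem_edgeSet, chainK4_adj] at he
      rw [Function.Embedding.sym2Map_apply, Sym2.map_mk, Sym2.eq_iff] at heq
      simp only [Fin.valEmbedding_apply] at heq
      omega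
    · intro h
      refine ⟨s(⟨a, by omega⟩, ⟨b, by omega⟩), ?_, rfl⟩
      rw [SimpleGraph.mem_edgeFinset, SimpleGraph.mem_edgeSet, chainK4_adj]
      simp only
      omega
  rw [treeSubCount_four _ _ (SimpleGraph.coe_edgeFinset _),
    ← card_treeEdgeSets_map Fin.valEmbedding, hmap,
    card_treeEdgeSets_chainEdges]

lemma cliqueCount_chainK4 (n : ℕ) (hn : 6 ≤ n) : cliqueCount (chainK4 n) 4 = 1 := by
  have hcard : ({i : Fin n | (i : ℕ) < 4} : Finset (Fin n)).card = 4 := by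
    rw [Fin.card_filter_val_lt]
    omega
  rw [cliqueCount, ← Finset.card_singleton ({i : Fin n | (i : ℕ) < 4} : Finset (Fin n))]
  refine Nat.subtype_card _ fun S => ?_
  rw [Finset.mem_singleton]
  constructor
  · rintro rfl
    refine ⟨hcard, fun i hi j hj hij => ?_⟩
    simp only [Finset.coe_filter, Finset.mem_univ, true_and, Set.mem_ofPred_eq] at hi hj
    exact chainK4_adj.2 ⟨Fin.val_ne_of_ne hij, Or.inl ⟨hi, hj⟩⟩
  · rintro ⟨hS, hclique⟩
    refine Finset.eq_of_subset_of_card_le (fun v hv => ?_) (by omega)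
    rw [Finset.mem_filter]
    refine ⟨Finset.mem_univ v, ?_⟩
    by_contra! hv4
    have hsub : S.map Fin.valEmbedding ⊆ {(v : ℕ) - 1, (v : ℕ), (v : ℕ) + 1} := by
      intro x hx
      obtain ⟨w, hw, rfl⟩ := Finset.mem_map.1 hx
      simp only [Finset.mem_insert, Finset.mem_singleton, Fin.valEmbedding_apply]
      by_cases hvw : v = w
      · simp [hvw]
      · have := chainK4_adj.1 (hclique hv hw hvw)
        omega
    have hle := (Finset.card_le_card hsub).trans Finset.card_le_three
    rw [Finset.card_map] at hle
    omega

theorem stmt14 (n : ℕ) (hn : 6 ≤ n) :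
    cliqueCount (chainK4 n) 4 = 1 ∧
    treeSubCount (chainK4 n) 4 = n + 22 ∧
    (16 * (cliqueCount (chainK4 n) 4 : ℚ)) / (treeSubCount (chainK4 n) 4 : ℚ) =
      16 / ((n : ℚ) + 22) ∧
    ((12 : ℚ) / ((n : ℚ) + 10) ≥ 16 / ((n : ℚ) + 22) ↔ n ≤ 26) ∧
    ((12 : ℚ) / ((n : ℚ) + 10) = 16 / ((n : ℚ) + 22) ↔ n = 26) := by
  have hclique := cliqueCount_chainK4 n hn
  have htree := treeSubCount_chainK4 n hn
  have h10 : (0 : ℚ) < (n : ℚ) + 10 := by positivity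
  have h22 : (0 : ℚ) < (n : ℚ) + 22 := by positivity
  refine ⟨hclique, htree, ?_, ?_, ?_⟩
  · rw [hclique, htree]
    push_cast
    ring
  · rw [ge_iff_le, div_le_div_iff₀ h22 h10]
    norm_cast
    omega
  · rw [div_eq_div_iff h10.ne' h22.ne']
    norm_cast
    omega
end

section
/- For an integer n ≥ 8, let H_n be the simple undirected graph on vertex set {0, 1, …, n−1} in which the vertices 0, 1, 2, 3, 4 are pairwise adjacent, vertices i and i+1 are adjacent for every i with 4 ≤ i ≤ n−2, and there are no other edges. Then H_n has exactly one 5-clique and exactly n + 203 5-vertex tree subgraphs, so C(5) = 125/(n + 203); moreover 80/(n + 95) ≥ 125/(n + 203) holds if and only if n ≤ 97, with equality exactly when n = 97. -/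
/-- The graph on `{0, 1, …, n-1}` in which `0, 1, 2, 3, 4` are pairwise adjacent, `i` and
`i + 1` are adjacent for every `4 ≤ i ≤ n - 2`, and there are no other edges. -/
def chainK5 (n : ℕ) : SimpleGraph (Fin n) :=
  SimpleGraph.fromRel (fun i j =>
    ((i : ℕ) < 5 ∧ (j : ℕ) < 5) ∨ ((j : ℕ) = (i : ℕ) + 1 ∧ 4 ≤ (i : ℕ)))

/-- A set `E` of pairs joins every proper nonempty subset of `S` to its complement. -/
def CrossesCuts (S : Finset ℕ) (E : Finset (ℕ × ℕ)) : Prop :=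
  ∀ T ∈ S.powerset, T.Nonempty → T ≠ S → ∃ e ∈ E, (e.1 ∈ T ∧ e.2 ∉ T) ∨ (e.1 ∉ T ∧ e.2 ∈ T)

instance (S : Finset ℕ) : DecidablePred (CrossesCuts S) := fun _ =>
  inferInstanceAs (Decidable (∀ _ ∈ _, _))

/-- The edges of the infinite chain with both ends in `S`, written with the smaller end first. -/
def chainPairs (S : Finset ℕ) : Finset (ℕ × ℕ) :=
  (S ×ˢ S).filter fun e => e.1 < e.2 ∧ (e.2 < 5 ∨ e.2 = e.1 + 1 ∧ 4 ≤ e.1)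

/-- The 5-vertex trees of the chain on `{0, …, n-1}`, with edges as increasing pairs. -/
def chainTrees (n : ℕ) : Finset (Finset ℕ × Finset (ℕ × ℕ)) :=
  ((Finset.range n).powersetCard 5).biUnion fun S =>
    (((chainPairs S).powersetCard 4).filter (CrossesCuts S)).image (Prod.mk S)

lemma mem_chainTrees {n : ℕ} {S : Finset ℕ} {E : Finset (ℕ × ℕ)} :
    (S, E) ∈ chainTrees n ↔
      (S ⊆ Finset.range n ∧ S.card = 5) ∧ (E ⊆ chainPairs S ∧ E.card = 4) ∧ CrossesCuts S E := by
  simp only [chainTrees, Finset.mem_biUnion, Finset.mem_powersetCard, Finset.mem_image,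
    Finset.mem_filter, Prod.mk.injEq]
  constructor
  · rintro ⟨S', h, E', h', rfl, rfl⟩
    exact ⟨h, h'⟩
  · rintro ⟨h, h'⟩
    exact ⟨S, h, E, h', rfl, rfl⟩

/-- For a 5-element set of vertices, only cuts with a side of at most two vertices matter. -/
lemma crossesCuts_iff_of_card_eq_five {S : Finset ℕ} {E : Finset (ℕ × ℕ)} (hS : S.card = 5)
    (hE : E ⊆ chainPairs S) :
    CrossesCuts S E ↔
      (∀ T ∈ S.powersetCard 1, ∃ e ∈ E, (e.1 ∈ T ∧ e.2 ∉ T) ∨ (e.1 ∉ T ∧ e.2 ∈ T)) ∧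
      ∀ T ∈ S.powersetCard 2, ∃ e ∈ E, (e.1 ∈ T ∧ e.2 ∉ T) ∨ (e.1 ∉ T ∧ e.2 ∈ T) := by
  constructor
  · intro h
    constructor <;>
    · intro T hT
      rw [Finset.mem_powersetCard] at hT
      exact h T (Finset.mem_powerset.2 hT.1) (Finset.card_pos.1 (by omega))
        (fun hEq => by rw [hEq] at hT; omega)
  · rintro ⟨h₁, h₂⟩ T hT hne hTS
    rw [Finset.mem_powerset] at hT
    have hpos := hne.card_pos
    have hlt := Finset.card_lt_card (Finset.ssubset_iff_subset_ne.2 ⟨hT, hTS⟩)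
    have hcompl := Finset.card_sdiff_of_subset hT
    have hsmall : ∀ U ⊆ S, U.card = 1 ∨ U.card = 2 →
        ∃ e ∈ E, (e.1 ∈ U ∧ e.2 ∉ U) ∨ (e.1 ∉ U ∧ e.2 ∈ U) := by
      rintro U hU (hc | hc)
      · exact h₁ U (Finset.mem_powersetCard.2 ⟨hU, hc⟩)
      · exact h₂ U (Finset.mem_powersetCard.2 ⟨hU, hc⟩)
    by_cases hT2 : T.card ≤ 2
    · exact hsmall T hT (by omega)
    · obtain ⟨e, he, h⟩ := hsmall (S \ T) Finset.sdiff_subset (by omega)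
      refine ⟨e, he, ?_⟩
      have hp := hE he
      simp only [chainPairs, Finset.mem_filter, Finset.mem_product] at hp
      simp only [Finset.mem_sdiff, hp.1.1, hp.1.2, true_and, not_not] at h
      exact h.symm

lemma card_chainTrees_eight : (chainTrees 8).card = 211 := by
  rw [chainTrees, Finset.card_biUnion]
  · have hcard : ∀ S ∈ (Finset.range 8).powersetCard 5,
        ((((chainPairs S).powersetCard 4).filter (CrossesCuts S)).image (Prod.mk S)).card =
        (((chainPairs S).powersetCard 4).filter fun E =>
          (∀ T ∈ S.powersetCard 1, ∃ e ∈ E, (e.1 ∈ T ∧ e.2 ∉ T) ∨ (e.1 ∉ T ∧ e.2 ∈ T)) ∧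
          ∀ T ∈ S.powersetCard 2, ∃ e ∈ E, (e.1 ∈ T ∧ e.2 ∉ T) ∨ (e.1 ∉ T ∧ e.2 ∈ T)).card := by
      intro S hS
      rw [Finset.card_image_of_injective _ (Prod.mk_right_injective _)]
      exact congrArg Finset.card (Finset.filter_congr fun E hE => crossesCuts_iff_of_card_eq_five
        (Finset.mem_powersetCard.1 hS).2 (Finset.mem_powersetCard.1 hE).1)
    rw [Finset.sum_congr rfl hcard]
    decide +kernel
  · intro S _ T _ hST
    rw [Function.onFun, Finset.disjoint_left]
    simp only [Finset.mem_image, not_exists, not_and]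
    rintro _ ⟨E, _, rfl⟩ F _ h
    exact hST (congrArg Prod.fst h).symm

/-- The edges of the path `k, k + 1, k + 2, k + 3, k + 4`. -/
def pathPairs (k : ℕ) : Finset (ℕ × ℕ) :=
  {(k, k + 1), (k + 1, k + 2), (k + 2, k + 3), (k + 3, k + 4)}

lemma card_pathPairs (k : ℕ) : (pathPairs k).card = 4 := by
  simp [pathPairs]

lemma crossesCuts_pathPairs (k : ℕ) : CrossesCuts (Finset.Icc k (k + 4)) (pathPairs k) := by
  intro T hT hne hTS
  rw [Finset.mem_powerset] at hT
  by_contra hcut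
  simp only [pathPairs, Finset.mem_insert, Finset.mem_singleton, exists_eq_or_imp,
    exists_eq_left, not_or] at hcut
  have iff_of_not {p q : Prop} (h : ¬(p ∧ ¬q) ∧ ¬(¬p ∧ q)) : p ↔ q := by tauto
  have h₁ := iff_of_not hcut.1
  have h₂ := iff_of_not hcut.2.1
  have h₃ := iff_of_not hcut.2.2.1
  have h₄ := iff_of_not hcut.2.2.2
  clear hcut
  obtain ⟨x, hx⟩ := hne
  have key : ∀ y ∈ Finset.Icc k (k + 4), (y ∈ T ↔ k ∈ T) := by
    intro y hy
    rw [Finset.mem_Icc] at hy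
    obtain rfl | rfl | rfl | rfl | rfl :
      y = k ∨ y = k + 1 ∨ y = k + 2 ∨ y = k + 3 ∨ y = k + 4 := by omega
    · rfl
    · exact h₁.symm
    · exact (h₁.trans h₂).symm
    · exact (h₁.trans (h₂.trans h₃)).symm
    · exact (h₁.trans (h₂.trans (h₃.trans h₄))).symm
  have hk := (key x (hT hx)).1 hx
  exact hTS (Finset.Subset.antisymm hT fun y hy => (key y hy).2 hk)

lemma pathPairs_mem_chainTrees {k : ℕ} (hk : 4 ≤ k) :
    (Finset.Icc k (k + 4), pathPairs k) ∈ chainTrees (k + 5) := by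
  refine mem_chainTrees.2 ⟨⟨fun x hx => ?_, by rw [Nat.card_Icc]; omega⟩, ⟨fun e he => ?_, card_pathPairs k⟩,
    crossesCuts_pathPairs k⟩
  · simp only [Finset.mem_Icc, Finset.mem_range] at hx ⊢
    omega
  · simp only [pathPairs, Finset.mem_insert, Finset.mem_singleton] at he
    simp only [chainPairs, Finset.mem_filter, Finset.mem_product, Finset.mem_Icc]
    rcases he with rfl | rfl | rfl | rfl <;> dsimp only <;> omega

/-- A 5-vertex tree of the chain with largest vertex `m` contains every edge `(j, j + 1)` with
`4 ≤ j < m ≤ j + 4`, the only edge joining `{x ≤ j}` to `{x > j}`. -/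
lemma pred_pair_mem_of_crossesCuts {S : Finset ℕ} {E : Finset (ℕ × ℕ)} {m j : ℕ}
    (hS : S.card = 5) (hle : ∀ x ∈ S, x ≤ m) (hm : m ∈ S) (hE : E ⊆ chainPairs S)
    (hcut : CrossesCuts S E) (hj : 4 ≤ j) (hjm : j < m) (hmj : m ≤ j + 4) :
    (j, j + 1) ∈ E := by
  obtain ⟨⟨a, b⟩, he, h⟩ := hcut (S.filter (j + 1 ≤ ·)) (by simp)
    ⟨m, Finset.mem_filter.2 ⟨hm, by omega⟩⟩ (fun h => by
      have hsub : S ⊆ Finset.Icc (j + 1) m := by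
        rw [← h]
        intro x hx
        simp only [Finset.mem_filter] at hx
        exact Finset.mem_Icc.2 ⟨hx.2, hle x hx.1⟩
      have := Finset.card_le_card hsub
      rw [Nat.card_Icc] at this
      omega)
  have hp := hE he
  simp only [chainPairs, Finset.mem_filter, Finset.mem_product] at hp h
  obtain ⟨⟨ha, hb⟩, hab⟩ := hp
  simp only [ha, hb, true_and] at h
  obtain ⟨rfl, rfl⟩ : a = j ∧ b = j + 1 := by omega
  exact he

lemma eq_pathPairs_of_mem_chainTrees {k : ℕ} (hk : 4 ≤ k) {S : Finset ℕ} {E : Finset (ℕ × ℕ)}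
    (h : (S, E) ∈ chainTrees (k + 5)) (hm : k + 4 ∈ S) :
    S = Finset.Icc k (k + 4) ∧ E = pathPairs k := by
  obtain ⟨⟨hS, hS5⟩, ⟨hE, hE4⟩, hcut⟩ := mem_chainTrees.1 h
  have hle : ∀ x ∈ S, x ≤ k + 4 := fun x hx => by
    have := Finset.mem_range.1 (hS hx)
    omega
  have hsub : pathPairs k ⊆ E := by
    have step : ∀ j, k ≤ j → j < k + 4 → (j, j + 1) ∈ E := fun j h₁ h₂ =>
      pred_pair_mem_of_crossesCuts hS5 hle hm hE hcut (by omega) h₂ (by omega)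
    intro e he
    simp only [pathPairs, Finset.mem_insert, Finset.mem_singleton] at he
    rcases he with rfl | rfl | rfl | rfl <;> exact step _ (by omega) (by omega)
  have hEq : pathPairs k = E := Finset.eq_of_subset_of_card_le hsub (by rw [hE4, card_pathPairs])
  refine ⟨(Finset.eq_of_subset_of_card_le (fun x hx => ?_)
    (by rw [hS5, Nat.card_Icc]; omega)).symm, hEq.symm⟩
  rw [Finset.mem_Icc] at hx
  rcases hx.2.eq_or_lt with rfl | hlt
  · exact hm
  · have hx' : (x, x + 1) ∈ E :=
      pred_pair_mem_of_crossesCuts hS5 hle hm hE hcut (by omega) hlt (by omega)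
    have := hE hx'
    simp only [chainPairs, Finset.mem_filter, Finset.mem_product] at this
    exact this.1.1

lemma chainTrees_succ {k : ℕ} (hk : 4 ≤ k) :
    chainTrees (k + 5) = insert (Finset.Icc k (k + 4), pathPairs k) (chainTrees (k + 4)) := by
  ext ⟨S, E⟩
  rw [Finset.mem_insert, Prod.mk.injEq]
  constructor
  · intro h
    by_cases hm : k + 4 ∈ S
    · exact Or.inl (eq_pathPairs_of_mem_chainTrees hk h hm)
    · obtain ⟨⟨hS, hS5⟩, h'⟩ := mem_chainTrees.1 h
      refine Or.inr (mem_chainTrees.2 ⟨⟨fun x hx => ?_, hS5⟩, h'⟩)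
      have h₁ := Finset.mem_range.1 (hS hx)
      have h₂ : x ≠ k + 4 := fun h => hm (h ▸ hx)
      exact Finset.mem_range.2 (by omega)
  · rintro (⟨rfl, rfl⟩ | h)
    · exact pathPairs_mem_chainTrees hk
    · obtain ⟨⟨hS, hS5⟩, h'⟩ := mem_chainTrees.1 h
      exact mem_chainTrees.2 ⟨⟨hS.trans (Finset.range_subset_range.2 (by omega)), hS5⟩, h'⟩

lemma card_chainTrees {n : ℕ} (hn : 8 ≤ n) : (chainTrees n).card = n + 203 := by
  induction n, hn using Nat.le_induction with
  | base => exact card_chainTrees_eight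
  | succ m hm ih =>
    obtain ⟨k, rfl⟩ : ∃ k, m = k + 4 := ⟨m - 4, by omega⟩
    rw [show k + 4 + 1 = k + 5 from rfl, chainTrees_succ (by omega), Finset.card_insert_of_notMem,
      ih]
    intro h
    have := Finset.mem_range.1 ((mem_chainTrees.1 h).1.1 (Finset.right_mem_Icc.2 (by omega)))
    omega

namespace SimpleGraph

variable {V : Type*}

/-- Vertices of `S` are pairwise reachable through edges inside `S` if and only if every proper
nonempty subset of `S` is joined to its complement. -/
lemma forall_reachable_fromEdgeSet_iff {S : Finset V} {E : Finset (Sym2 V)}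
    (hES : ∀ e ∈ E, ∀ v ∈ e, v ∈ S) :
    (∀ u ∈ S, ∀ v ∈ S, (fromEdgeSet (E : Set (Sym2 V))).Reachable u v) ↔
      ∀ T ⊆ S, T.Nonempty → T ≠ S → ∃ a ∈ T, ∃ b ∉ T, s(a, b) ∈ E := by
  classical
  constructor
  · rintro h T hT ⟨u, hu⟩ hne
    obtain ⟨v, hv, hvT⟩ := Finset.exists_of_ssubset (Finset.ssubset_iff_subset_ne.2 ⟨hT, hne⟩)
    obtain ⟨p⟩ := h u (hT hu) v hv
    obtain ⟨d, -, ha, hb⟩ := p.exists_boundary_dart (T : Set V) hu hvT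
    exact ⟨d.fst, ha, d.snd, hb, ((fromEdgeSet_adj _).1 d.adj).1⟩
  · intro h u hu v hv
    let T := S.filter ((fromEdgeSet (E : Set (Sym2 V))).Reachable u)
    have hTS : T = S := by
      by_contra hne
      obtain ⟨a, ha, b, hb, hab⟩ := h T (Finset.filter_subset _ _)
        ⟨u, Finset.mem_filter.2 ⟨hu, Reachable.refl u⟩⟩ hne
      refine hb (Finset.mem_filter.2 ⟨hES _ hab b (Sym2.mem_mk_right a b), ?_⟩)
      refine (Finset.mem_filter.1 ha).2.trans (Adj.reachable ?_)
      exact (fromEdgeSet_adj _).2 ⟨hab, fun hEq => hb (hEq ▸ ha)⟩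
    exact (Finset.mem_filter.1 (hTS.symm ▸ hv : v ∈ T)).2

lemma Reachable.induce_of_adj_mem {G : SimpleGraph V} {s : Set V}
    (hs : ∀ a b, G.Adj a b → b ∈ s) {u v : V} (h : G.Reachable u v) (hu : u ∈ s) (hv : v ∈ s) :
    (G.induce s).Reachable ⟨u, hu⟩ ⟨v, hv⟩ := by
  obtain ⟨p⟩ := h
  induction p with
  | nil => exact Reachable.refl _
  | @cons a b c hab p ih =>
    have hadj : (G.induce s).Adj ⟨a, hu⟩ ⟨b, hs a b hab⟩ := hab
    exact hadj.reachable.trans (ih _ hv)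

/-- A loopless edge set connecting `S` with fewer than `S.card` edges, all inside `S`, is acyclic. -/
lemma isAcyclic_fromEdgeSet_of_card_lt {S : Finset V} {E : Finset (Sym2 V)}
    (hES : ∀ e ∈ E, ∀ v ∈ e, v ∈ S) (hcard : E.card < S.card)
    (h : ∀ u ∈ S, ∀ v ∈ S, (fromEdgeSet (E : Set (Sym2 V))).Reachable u v) :
    (fromEdgeSet (E : Set (Sym2 V))).IsAcyclic := by
  obtain ⟨F, hF, hacyc, hreach⟩ := exists_isAcyclic_reachable_eq_le (G := fromEdgeSet (E : Set (Sym2 V)))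
  have hFE : F.edgeSet ⊆ E := fun e he =>
    ((edgeSet_fromEdgeSet _).subset (edgeSet_mono hF he)).1
  have hconn : (F.induce (S : Set V)).Connected := by
    have : Nonempty (S : Set V) := by
      obtain ⟨x, hx⟩ := Finset.card_pos.1 (Nat.zero_lt_of_lt hcard)
      exact ⟨⟨x, hx⟩⟩
    refine ⟨fun u v => Reachable.induce_of_adj_mem (fun a b hab => ?_) ?_ u.2 v.2⟩
    · exact hES s(a, b) (hFE hab) b (Sym2.mem_mk_right a b)
    · rw [hreach]
      exact h u u.2 v v.2
  have hle := hconn.card_vert_le_card_edgeSet_add_one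
  have hfin : F.edgeSet.Finite := E.finite_toSet.subset hFE
  have hle' : Nat.card (F.induce (S : Set V)).edgeSet ≤ F.edgeSet.ncard := by
    have := hfin.to_subtype
    exact Nat.card_le_card_of_injective _ (Embedding.induce (S : Set V)).mapEdgeSet.injective
  have hEq : F.edgeSet = E := by
    refine Set.eq_of_subset_of_ncard_le hFE ?_ E.finite_toSet
    have : Nat.card (S : Set V) = S.card := by simp
    rw [Set.ncard_coe_finset]
    omega
  rwa [← hEq, fromEdgeSet_edgeSet]

end SimpleGraph

/-- An unordered pair in `Fin n` as an increasing pair of natural numbers. -/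
def sortedPair {n : ℕ} (e : Sym2 (Fin n)) : ℕ × ℕ := ((e.inf : Fin n), (e.sup : Fin n))

lemma sortedPair_mk {n : ℕ} (a b : Fin n) :
    sortedPair s(a, b) = (min (a : ℕ) b, max (a : ℕ) b) := by
  simp [sortedPair]

lemma sortedPair_injective {n : ℕ} : Function.Injective (sortedPair (n := n)) := by
  intro e f
  induction e with | _ a b
  induction f with | _ c d
  rw [sortedPair_mk, sortedPair_mk, Sym2.eq_iff, Prod.mk.injEq]
  simp only [Fin.ext_iff]
  omega

lemma chainK5_adj {n : ℕ} (a b : Fin n) :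
    (chainK5 n).Adj a b ↔ min (a : ℕ) b < max (a : ℕ) b ∧
      (max (a : ℕ) b < 5 ∨ max (a : ℕ) b = min (a : ℕ) b + 1 ∧ 4 ≤ min (a : ℕ) b) := by
  rw [chainK5, SimpleGraph.fromRel_adj, ne_eq, Fin.ext_iff]
  omega

lemma image_sortedPair_subset_chainPairs {n : ℕ} {S : Finset (Fin n)} {E : Finset (Sym2 (Fin n))} :
    E.image sortedPair ⊆ chainPairs (S.map Fin.valEmbedding) ↔
      (∀ e ∈ E, e ∈ (chainK5 n).edgeSet) ∧ ∀ e ∈ E, ∀ v ∈ e, v ∈ S := by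
  rw [← forall₂_and, Finset.image_subset_iff]
  refine forall₂_congr fun e _ => ?_
  induction e with | _ a b
  have hmem (x : Fin n) : (x : ℕ) ∈ S.map Fin.valEmbedding ↔ x ∈ S :=
    Finset.mem_map' Fin.valEmbedding
  rw [sortedPair_mk, SimpleGraph.mem_edgeSet, chainK5_adj, chainPairs, Finset.mem_filter,
    Finset.mem_product, and_comm]
  simp only [Sym2.mem_iff, forall_eq_or_imp, forall_eq]
  refine and_congr_right fun _ => ?_
  rcases le_total (a : ℕ) b with h | h
  · rw [min_eq_left h, max_eq_right h, hmem, hmem]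
  · rw [min_eq_right h, max_eq_left h, hmem, hmem, and_comm]

lemma exists_sortedPair_crossing_iff {n : ℕ} {T : Finset (Fin n)} {E : Finset (Sym2 (Fin n))} :
    (∃ e ∈ E.image sortedPair,
      (e.1 ∈ T.map Fin.valEmbedding ∧ e.2 ∉ T.map Fin.valEmbedding) ∨
      (e.1 ∉ T.map Fin.valEmbedding ∧ e.2 ∈ T.map Fin.valEmbedding)) ↔
      ∃ a ∈ T, ∃ b ∉ T, s(a, b) ∈ E := by
  have hmem (x : Fin n) : (x : ℕ) ∈ T.map Fin.valEmbedding ↔ x ∈ T :=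
    Finset.mem_map' Fin.valEmbedding
  rw [Finset.exists_mem_image]
  constructor
  · rintro ⟨e, he, h⟩
    induction e with | _ a b
    rw [sortedPair_mk] at h
    have h' : (a ∈ T ∧ b ∉ T) ∨ (b ∈ T ∧ a ∉ T) := by
      rcases le_total (a : ℕ) b with hab | hab
      · simp only [min_eq_left hab, max_eq_right hab, hmem] at h
        tauto
      · simp only [min_eq_right hab, max_eq_left hab, hmem] at h
        tauto
    rcases h' with ⟨ha, hb⟩ | ⟨hb, ha⟩
    · exact ⟨a, ha, b, hb, he⟩
    · exact ⟨b, hb, a, ha, Sym2.eq_swap ▸ he⟩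
  · rintro ⟨a, ha, b, hb, he⟩
    refine ⟨s(a, b), he, ?_⟩
    rw [sortedPair_mk]
    rcases le_total (a : ℕ) b with hab | hab
    · simp only [min_eq_left hab, max_eq_right hab, hmem]
      tauto
    · simp only [min_eq_right hab, max_eq_left hab, hmem]
      tauto

lemma crossesCuts_map_iff {n : ℕ} {S : Finset (Fin n)} {E : Finset (Sym2 (Fin n))} :
    CrossesCuts (S.map Fin.valEmbedding) (E.image sortedPair) ↔
      ∀ T ⊆ S, T.Nonempty → T ≠ S → ∃ a ∈ T, ∃ b ∉ T, s(a, b) ∈ E := by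
  constructor
  · intro h T hT hne hTS
    exact exists_sortedPair_crossing_iff.1 (h (T.map Fin.valEmbedding)
      (Finset.mem_powerset.2 (Finset.map_subset_map.2 hT)) (hne.map)
      (fun hEq => hTS (Finset.map_injective _ hEq)))
  · intro h T' hT' hne hTS
    obtain ⟨T, hT, rfl⟩ := Finset.subset_map_iff.1 (Finset.mem_powerset.1 hT')
    exact exists_sortedPair_crossing_iff.2
      (h T hT (Finset.map_nonempty.1 hne) (fun hEq => hTS (hEq ▸ rfl)))

lemma map_mem_chainTrees_iff {n : ℕ} {S : Finset (Fin n)} {E : Finset (Sym2 (Fin n))} :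
    (S.map Fin.valEmbedding, E.image sortedPair) ∈ chainTrees n ↔
      S.card = 5 ∧ E.card = 5 - 1 ∧ (∀ e ∈ E, e ∈ (chainK5 n).edgeSet) ∧
      (∀ e ∈ E, ∀ v ∈ e, v ∈ S) ∧
      (∀ u ∈ S, ∀ v ∈ S, (SimpleGraph.fromEdgeSet (E : Set (Sym2 (Fin n)))).Reachable u v) ∧
      (SimpleGraph.fromEdgeSet (E : Set (Sym2 (Fin n)))).IsAcyclic := by
  have hrange : S.map Fin.valEmbedding ⊆ Finset.range n := by
    intro x hx
    obtain ⟨y, -, rfl⟩ := Finset.mem_map.1 hx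
    exact Finset.mem_range.2 y.2
  rw [mem_chainTrees, crossesCuts_map_iff, image_sortedPair_subset_chainPairs, Finset.card_map,
    Finset.card_image_of_injective _ sortedPair_injective]
  constructor
  · rintro ⟨⟨-, hS⟩, ⟨⟨hG, hES⟩, hE⟩, hcut⟩
    have hreach := (SimpleGraph.forall_reachable_fromEdgeSet_iff hES).2 hcut
    exact ⟨hS, hE, hG, hES, hreach,
      SimpleGraph.isAcyclic_fromEdgeSet_of_card_lt hES (by omega) hreach⟩
  · rintro ⟨hS, hE, hG, hES, hreach, -⟩
    exact ⟨⟨hrange, hS⟩, ⟨⟨hG, hES⟩, hE⟩,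
      (SimpleGraph.forall_reachable_fromEdgeSet_iff hES).1 hreach⟩

lemma exists_map_eq_of_mem_chainTrees {n : ℕ} {q : Finset ℕ × Finset (ℕ × ℕ)}
    (hq : q ∈ chainTrees n) :
    ∃ p : Finset (Fin n) × Finset (Sym2 (Fin n)),
      (p.1.map Fin.valEmbedding, p.2.image sortedPair) = q := by
  obtain ⟨S, E⟩ := q
  obtain ⟨⟨hS, -⟩, ⟨hE, -⟩, -⟩ := mem_chainTrees.1 hq
  refine ⟨(Finset.univ.filter fun x => (x : ℕ) ∈ S,
    Finset.univ.filter fun e => sortedPair e ∈ E), Prod.ext ?_ ?_⟩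
  · ext x
    simp only [Finset.mem_map, Finset.mem_filter, Finset.mem_univ, true_and,
      Fin.valEmbedding_apply]
    exact ⟨fun ⟨y, hy, hyx⟩ => hyx ▸ hy, fun hx => ⟨⟨x, Finset.mem_range.1 (hS hx)⟩, hx, rfl⟩⟩
  · ext ⟨a, b⟩
    simp only [Finset.mem_image, Finset.mem_filter, Finset.mem_univ, true_and]
    refine ⟨fun ⟨e, he, hEq⟩ => hEq ▸ he, fun he => ?_⟩
    have hp := hE he
    simp only [chainPairs, Finset.mem_filter, Finset.mem_product] at hp
    obtain ⟨⟨ha, hb⟩, hab, -⟩ := hp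
    have hEq : sortedPair s((⟨a, Finset.mem_range.1 (hS ha)⟩ : Fin n),
        ⟨b, Finset.mem_range.1 (hS hb)⟩) = (a, b) := by
      rw [sortedPair_mk, min_eq_left hab.le, max_eq_right hab.le]
    exact ⟨_, hEq.symm ▸ he, hEq⟩

lemma treeSubCount_chainK5_five (n : ℕ) : treeSubCount (chainK5 n) 5 = (chainTrees n).card := by
  let f : Finset (Fin n) × Finset (Sym2 (Fin n)) → Finset ℕ × Finset (ℕ × ℕ) :=
    Prod.map (Finset.map Fin.valEmbedding) (Finset.image sortedPair)
  have hf : Function.Injective f :=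
    (Finset.map_injective _).prodMap (Finset.image_injective sortedPair_injective)
  rw [treeSubCount, ← Set.ncard_coe_finset,
    ← Set.ncard_preimage_of_injective_subset_range hf (s := (chainTrees n : Set _))
      (fun q hq => exists_map_eq_of_mem_chainTrees hq)]
  exact Nat.card_congr (Equiv.subtypeEquivRight fun p => map_mem_chainTrees_iff.symm)

lemma cliqueCount_chainK5_five {n : ℕ} (hn : 8 ≤ n) : cliqueCount (chainK5 n) 5 = 1 := by
  have hcard : (Finset.univ.filter fun x : Fin n => (x : ℕ) < 5).card = 5 := by
    rw [Fin.card_filter_val_lt]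
    omega
  rw [cliqueCount, Nat.card_eq_one_iff_exists]
  refine ⟨⟨Finset.univ.filter fun x => (x : ℕ) < 5, hcard, fun a ha b hb hab => ?_⟩, ?_⟩
  · simp only [Finset.coe_filter, Finset.mem_univ, true_and, Set.mem_ofPred_eq] at ha hb
    rw [ne_eq, Fin.ext_iff] at hab
    rw [chainK5_adj]
    omega
  · rintro ⟨S, hS, hclique⟩
    refine Subtype.ext (Finset.eq_of_subset_of_card_le (fun x hx => ?_) (by rw [hcard, hS]))
    rw [Finset.mem_filter]
    refine ⟨Finset.mem_univ _, ?_⟩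
    by_contra hx5
    have hsub : S.map Fin.valEmbedding ⊆ Finset.Icc ((x : ℕ) - 1) (x + 1) := by
      intro y hy
      obtain ⟨y, hyS, rfl⟩ := Finset.mem_map.1 hy
      rw [Fin.valEmbedding_apply, Finset.mem_Icc]
      by_cases hxy : x = y
      · subst hxy
        omega
      · have := (chainK5_adj x y).1 (hclique hx hyS hxy)
        omega
    have := Finset.card_le_card hsub
    rw [Finset.card_map, hS, Nat.card_Icc] at this
    omega

theorem stmt16 (n : ℕ) (hn : 8 ≤ n) :
    cliqueCount (chainK5 n) 5 = 1 ∧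
    treeSubCount (chainK5 n) 5 = n + 203 ∧
    (125 * (cliqueCount (chainK5 n) 5 : ℚ)) / (treeSubCount (chainK5 n) 5 : ℚ) =
      125 / ((n : ℚ) + 203) ∧
    ((80 : ℚ) / ((n : ℚ) + 95) ≥ 125 / ((n : ℚ) + 203) ↔ n ≤ 97) ∧
    ((80 : ℚ) / ((n : ℚ) + 95) = 125 / ((n : ℚ) + 203) ↔ n = 97) := by
  have hpos : (0 : ℚ) < (n : ℚ) + 95 := by positivity
  have hpos' : (0 : ℚ) < (n : ℚ) + 203 := by positivity
  have htree : treeSubCount (chainK5 n) 5 = n + 203 := by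
    rw [treeSubCount_chainK5_five, card_chainTrees hn]
  have hclique := cliqueCount_chainK5_five hn
  refine ⟨hclique, htree, ?_, ?_, ?_⟩
  · rw [hclique, htree]
    push_cast
    ring
  · rw [ge_iff_le, div_le_div_iff₀ hpos' hpos]
    constructor
    · intro h
      have h' : (n : ℚ) ≤ 97 := by linarith
      exact_mod_cast h'
    · intro h
      have h' : (n : ℚ) ≤ 97 := by exact_mod_cast h
      linarith
  · rw [div_eq_div_iff hpos.ne' hpos'.ne']
    constructor
    · intro h
      have h' : (n : ℚ) = 97 := by linarith
      exact_mod_cast h'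
    · rintro rfl
      norm_num
end
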